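/- arXiv:1703.10374 — 3 statements merged into one kernel-verified Lean document; each statement's English description precedes it below -/
import Mathlib

section
/- Let X be a topological space over B0 and let p : X → X = (X_α, p_{αα'}, 𝒜) be a resolution over B0. Then p is a strong expansion over B0, i.e. p satisfies conditions (E1) and (SE2). -/
open Set Topology TopologicalSpace unitInterval

universe u

/-- `f` is a fiber preserving (f.p.) map from `(X, πX)` to `(Y, πY)` over `B0`. -/
def IsFPMap {B0 X Y : Type u} [TopologicalSpace B0] [TopologicalSpace X] [TopologicalSpace Y]
    (πX : X → B0) (πY : Y → B0) (f : X → Y) : Prop :=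
  Continuous f ∧ ∀ x, πY (f x) = πX x

/-- Two f.p. maps are f.p. homotopic (homotopic over `B0`). -/
def FPHomotopic {B0 X Y : Type u} [TopologicalSpace B0] [TopologicalSpace X] [TopologicalSpace Y]
    (πX : X → B0) (πY : Y → B0) (f g : X → Y) : Prop :=
  ∃ H : X × unitInterval → Y, Continuous H ∧
    (∀ x, H (x, 0) = f x) ∧ (∀ x, H (x, 1) = g x) ∧
    ∀ x t, πY (H (x, t)) = πX x

/-- A metrizable space `(Y, πY)` over `B0` is an absolute neighbourhood retract over `B0`:
for every closed f.p. embedding into a metrizable space over `B0` there is a neighbourhood of the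
image and an f.p. retraction of that neighbourhood onto the image. -/
def IsFiberANR (B0 : Type u) [TopologicalSpace B0] (Y : Type u) [TopologicalSpace Y]
    (πY : Y → B0) : Prop :=
  MetrizableSpace Y ∧ Continuous πY ∧
  ∀ (X : Type u) (_ : TopologicalSpace X), MetrizableSpace X →
    ∀ πX : X → B0, Continuous πX →
    ∀ i : Y → X, IsClosedEmbedding i → (∀ y, πX (i y) = πY y) →
    ∃ U : Set X, U ∈ nhdsSet (Set.range i) ∧
    ∃ r : U → X, Continuous r ∧ (∀ u : U, r u ∈ Set.range i) ∧
      (∀ u : U, πX (r u) = πX u) ∧ ∀ u : U, (u : X) ∈ Set.range i → r u = u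

/-- A metrizable space `(Y, πY)` over `B0` is an absolute neighbourhood extensor over `B0`. -/
def IsFiberANE (B0 : Type u) [TopologicalSpace B0] (Y : Type u) [TopologicalSpace Y]
    (πY : Y → B0) : Prop :=
  MetrizableSpace Y ∧ Continuous πY ∧
  ∀ (X : Type u) (_ : TopologicalSpace X), MetrizableSpace X →
    ∀ πX : X → B0, Continuous πX →
    ∀ A : Set X, IsClosed A →
    ∀ f : A → Y, Continuous f → (∀ a : A, πY (f a) = πX a) →
    ∃ U : Set X, U ∈ nhdsSet A ∧
    ∃ g : U → Y, Continuous g ∧ (∀ u : U, πY (g u) = πX u) ∧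
      ∀ (a : X) (ha : a ∈ A) (hu : a ∈ U), g ⟨a, hu⟩ = f ⟨a, ha⟩

/-- An open cover of a topological space. -/
def IsOpenCover {Y : Type u} [TopologicalSpace Y] (𝒰 : Set (Set Y)) : Prop :=
  (∀ V ∈ 𝒰, IsOpen V) ∧ ⋃₀ 𝒰 = Set.univ

/-- Two maps are `𝒰`-near. -/
def UNear {X Y : Type u} (𝒰 : Set (Set Y)) (f g : X → Y) : Prop :=
  ∀ x, ∃ V ∈ 𝒰, f x ∈ V ∧ g x ∈ V

/-- The (topological) weight of a space: the least cardinality of a basis of its topology. -/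
noncomputable def tweight (X : Type u) [TopologicalSpace X] : Cardinal.{u} :=
  sInf {c | ∃ B : Set (Set X), IsTopologicalBasis B ∧ Cardinal.mk B = c}

/-- An inverse system in `Top_{B0}`: a directed set of indices, spaces over `B0` and f.p.
bonding maps. -/
structure FibInvSys (B0 : Type u) [TopologicalSpace B0] : Type (u + 1) where
  Idx : Type u
  le : Idx → Idx → Prop
  le_refl : ∀ a, le a a
  le_trans : ∀ a b c, le a b → le b c → le a c
  directed : ∀ a b, ∃ c, le a c ∧ le b c
  obj : Idx → Type u
  topInst : ∀ a, TopologicalSpace (obj a)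
  proj : ∀ a, obj a → B0
  proj_cont : ∀ a, @Continuous _ _ (topInst a) _ (proj a)
  bond : ∀ a a', le a a' → obj a' → obj a
  bond_cont : ∀ a a' (h : le a a'), @Continuous _ _ (topInst a') (topInst a) (bond a a' h)
  bond_fp : ∀ a a' (h : le a a') (x : obj a'), proj a (bond a a' h x) = proj a' x
  bond_id : ∀ a (x : obj a), bond a a (le_refl a) x = x
  bond_comp : ∀ a a' a'' (h : le a a') (h' : le a' a'') (x : obj a''),
    bond a a' h (bond a' a'' h' x) = bond a a'' (le_trans a a' a'' h h') x

attribute [instance] FibInvSys.topInst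

/-- A morphism from a space `(X, πX)` over `B0` to an inverse system in `Top_{B0}`. -/
structure FibMapToSys {B0 : Type u} [TopologicalSpace B0] (X : Type u) [TopologicalSpace X]
    (πX : X → B0) (S : FibInvSys B0) where
  maps : ∀ a : S.Idx, X → S.obj a
  cont : ∀ a, Continuous (maps a)
  fp : ∀ a x, S.proj a (maps a x) = πX x
  comm : ∀ a a' (h : S.le a a') (x : X), S.bond a a' h (maps a' x) = maps a x

section Conditions

variable {B0 : Type u} [TopologicalSpace B0] (X : Type u) [TopologicalSpace X]
  (πX : X → B0) (S : FibInvSys B0)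

/-- Condition (R1) of a resolution over `B0`. -/
def CondR1 (p : FibMapToSys X πX S) : Prop :=
  ∀ (P : Type u) (_ : TopologicalSpace P) (πP : P → B0), IsFiberANR B0 P πP →
    ∀ 𝒰 : Set (Set P), IsOpenCover 𝒰 →
    ∀ h : X → P, IsFPMap πX πP h →
    ∃ (a : S.Idx) (f : S.obj a → P), IsFPMap (S.proj a) πP f ∧
      UNear 𝒰 h fun x => f (p.maps a x)

/-- Condition (R2) of a resolution over `B0`. -/
def CondR2 (p : FibMapToSys X πX S) : Prop :=
  ∀ (P : Type u) (_ : TopologicalSpace P) (πP : P → B0), IsFiberANR B0 P πP →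
    ∀ 𝒰 : Set (Set P), IsOpenCover 𝒰 →
    ∃ 𝒰' : Set (Set P), IsOpenCover 𝒰' ∧
      ∀ (a : S.Idx) (f f' : S.obj a → P), IsFPMap (S.proj a) πP f → IsFPMap (S.proj a) πP f' →
        UNear 𝒰' (fun x => f (p.maps a x)) (fun x => f' (p.maps a x)) →
        ∃ (a' : S.Idx) (h : S.le a a'),
          UNear 𝒰 (fun y => f (S.bond a a' h y)) fun y => f' (S.bond a a' h y)

/-- `p` is a resolution over `B0`. -/
def IsFibResolution (p : FibMapToSys X πX S) : Prop :=
  CondR1 X πX S p ∧ CondR2 X πX S p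

/-- Condition (E1) of an expansion over `B0`. -/
def CondE1 (p : FibMapToSys X πX S) : Prop :=
  ∀ (P : Type u) (_ : TopologicalSpace P) (πP : P → B0), IsFiberANR B0 P πP →
    ∀ f : X → P, IsFPMap πX πP f →
    ∃ (a : S.Idx) (h : S.obj a → P), IsFPMap (S.proj a) πP h ∧
      FPHomotopic πX πP (fun x => h (p.maps a x)) f

/-- Condition (E2) of an expansion over `B0`. -/
def CondE2 (p : FibMapToSys X πX S) : Prop :=
  ∀ (P : Type u) (_ : TopologicalSpace P) (πP : P → B0), IsFiberANR B0 P πP →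
    ∀ (a : S.Idx) (f f' : S.obj a → P), IsFPMap (S.proj a) πP f → IsFPMap (S.proj a) πP f' →
      FPHomotopic πX πP (fun x => f (p.maps a x)) (fun x => f' (p.maps a x)) →
      ∃ (a' : S.Idx) (h : S.le a a'),
        FPHomotopic (S.proj a') πP (fun y => f (S.bond a a' h y)) fun y => f' (S.bond a a' h y)

/-- Two f.p. homotopies `S, T : X × I → P` are f.p. homotopic rel `X × ∂I`. -/
def FPHomotopicRelEnds {P : Type u} [TopologicalSpace P] (πP : P → B0)
    (S T : X × unitInterval → P) : Prop :=
  ∃ G : (X × unitInterval) × unitInterval → P, Continuous G ∧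
    (∀ z, G (z, 0) = S z) ∧ (∀ z, G (z, 1) = T z) ∧
    (∀ z s, πP (G (z, s)) = πX z.1) ∧
    (∀ x s, G ((x, 0), s) = S (x, 0)) ∧ ∀ x s, G ((x, 1), s) = S (x, 1)

/-- Condition (SE2) of a strong expansion over `B0`. -/
def CondSE2 (p : FibMapToSys X πX S) : Prop :=
  ∀ (P : Type u) (_ : TopologicalSpace P) (πP : P → B0), IsFiberANR B0 P πP →
    ∀ (a : S.Idx) (f0 f1 : S.obj a → P), IsFPMap (S.proj a) πP f0 → IsFPMap (S.proj a) πP f1 →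
    ∀ Sh : X × unitInterval → P, Continuous Sh → (∀ x t, πP (Sh (x, t)) = πX x) →
      (∀ x, Sh (x, 0) = f0 (p.maps a x)) → (∀ x, Sh (x, 1) = f1 (p.maps a x)) →
      ∃ (a' : S.Idx) (h : S.le a a') (H : S.obj a' × unitInterval → P),
        Continuous H ∧ (∀ z t, πP (H (z, t)) = S.proj a' z) ∧
        (∀ z, H (z, 0) = f0 (S.bond a a' h z)) ∧
        (∀ z, H (z, 1) = f1 (S.bond a a' h z)) ∧
        FPHomotopicRelEnds X πX πP Sh fun zt => H (p.maps a' zt.1, zt.2)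

/-- `p` is a strong expansion over `B0`. -/
def IsFibStrongExpansion (p : FibMapToSys X πX S) : Prop :=
  CondE1 X πX S p ∧ CondSE2 X πX S p

end Conditions


theorem aux_dugundji {X E : Type u} [MetricSpace X] [NormedAddCommGroup E] [NormedSpace ℝ E]
    {A : Set X} (hA : IsClosed A) (hne : A.Nonempty) (C : Set E) (hC : Convex ℝ C)
    (f : A → E) (hf : Continuous f) (hfC : ∀ a, f a ∈ C) :
    ∃ F : X → E, Continuous F ∧ (∀ x, F x ∈ C) ∧ ∀ a : A, F a = f a := by
  classical
  let N : X → Set A := fun x => {a | dist x a < 2 * Metric.infDist x A}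
  let T : (Aᶜ : Set X) → Set E := fun x => convexHull ℝ (f '' N x)
  have hpos : ∀ x ∉ A, 0 < Metric.infDist x A := fun x hx =>
    (hA.notMem_iff_infDist_pos hne).1 hx
  obtain ⟨g, hg⟩ : ∃ g : C((Aᶜ : Set X), E), ∀ x, g x ∈ T x := by
    apply exists_continuous_forall_mem_convex_of_local
    · intro x; exact convex_convexHull ℝ _
    · intro x
      have hx := hpos x x.2
      obtain ⟨a, haA, ha⟩ := (Metric.infDist_lt_iff hne).1
        (show Metric.infDist (x : X) A < 2 * Metric.infDist (x : X) A by linarith)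
      refine ⟨{y | dist (y : X) a < 2 * Metric.infDist (y : X) A}, ?_, fun _ => f ⟨a, haA⟩,
        continuousOn_const, ?_⟩
      · refine IsOpen.mem_nhds (s := {y : (Aᶜ : Set X) | dist (y : X) a <
          2 * Metric.infDist (y : X) A}) ?_ ha
        apply isOpen_lt
        · fun_prop
        · exact continuous_const.mul ((Metric.continuous_infDist_pt A).comp continuous_subtype_val)
      · intro y hy
        exact subset_convexHull ℝ _ ⟨⟨a, haA⟩, hy, rfl⟩
  let F : X → E := fun x => if h : x ∈ A then f ⟨x, h⟩ else g ⟨x, h⟩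
  have hFA : ∀ (x) (h : x ∈ A), F x = f ⟨x, h⟩ := fun x h => dif_pos h
  have hFn : ∀ (x) (h : x ∉ A), F x = g ⟨x, h⟩ := fun x h => dif_neg h
  refine ⟨F, ?_, ?_, fun a => hFA a a.2⟩
  · rw [continuous_iff_continuousAt]
    intro x
    by_cases hx : x ∈ A
    · rw [Metric.continuousAt_iff]
      intro ε hε
      obtain ⟨δ, hδ, hd⟩ := Metric.continuous_iff.1 hf ⟨x, hx⟩ ε hε
      refine ⟨δ / 3, by positivity, ?_⟩
      intro y hy
      rw [hFA x hx]
      by_cases hyA : y ∈ A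
      · rw [hFA y hyA]
        exact hd ⟨y, hyA⟩ (by rw [Subtype.dist_eq]; dsimp only; linarith)
      · rw [hFn y hyA]
        have h1 : T ⟨y, hyA⟩ ⊆ Metric.ball (f ⟨x, hx⟩) ε := by
          apply convexHull_min _ (convex_ball _ _)
          rintro _ ⟨b, hb, rfl⟩
          apply hd
          have hb' : dist y b < 2 * Metric.infDist y A := hb
          have h2 : Metric.infDist y A ≤ dist y x := Metric.infDist_le_dist_of_mem hx
          rw [Subtype.dist_eq]
          have h3 := dist_triangle_left (b : X) x y
          dsimp only
          linarith
        exact h1 (hg _)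
    · have : ContinuousOn F Aᶜ := by
        rw [continuousOn_iff_continuous_domRestrict]
        refine g.continuous.congr ?_
        intro z
        exact (hFn z z.2).symm
      exact this.continuousAt (hA.isOpen_compl.mem_nhds hx)
  · intro x
    by_cases hx : x ∈ A
    · rw [hFA x hx]; exact hfC _
    · rw [hFn x hx]
      refine convexHull_min ?_ hC (hg _)
      rintro _ ⟨b, _, rfl⟩
      exact hfC b

open BoundedContinuousFunction in
theorem aux_pkg {B0 P : Type u} [TopologicalSpace B0] [MetrizableSpace B0] [TopologicalSpace P]
    {π : P → B0} (hP : IsFiberANR B0 P π) :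
    ∃ (C : Set (P →ᵇ ℝ)) (j : P → C) (U : Set (B0 × C)) (r : U → P),
      Convex ℝ C ∧ Continuous j ∧ IsOpen U ∧ (∀ x, (π x, j x) ∈ U) ∧ Continuous r ∧
      (∀ u, π (r u) = u.1.1) ∧ ∀ x (h : (π x, j x) ∈ U), r ⟨_, h⟩ = x := by
  obtain ⟨hM, hπ, hret⟩ := hP
  let : MetricSpace P := metrizableSpaceMetric P
  let J : P → (P →ᵇ ℝ) := fun x => BoundedContinuousFunction.ofNormedAddCommGroup
    (fun y => min (dist x y) 1) (by fun_prop) 1 (fun y => by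
      rw [Real.norm_of_nonneg (le_min dist_nonneg zero_le_one)]; exact min_le_right _ _)
  have hJ : ∀ x y, J x y = min (dist x y) 1 := fun x y => rfl
  let C : Set (P →ᵇ ℝ) := {z | ∃ k : P, ∃ c : ℝ, 0 < c ∧ ∀ y, c * min (dist k y) 1 ≤ z y}
  have hmin : ∀ x y : P, 0 ≤ min (dist x y) 1 := fun x y => le_min dist_nonneg zero_le_one
  have hC : Convex ℝ C := by
    rintro z ⟨k, c, hc, hz⟩ z' ⟨k', c', hc', hz'⟩ a b ha hb hab
    have hz0 : ∀ y, 0 ≤ z y := fun y => (mul_nonneg hc.le (hmin _ _)).trans (hz y)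
    have hz0' : ∀ y, 0 ≤ z' y := fun y => (mul_nonneg hc'.le (hmin _ _)).trans (hz' y)
    rcases ha.eq_or_lt with h | h
    · have : b = 1 := by linarith
      subst this; subst h
      exact ⟨k', c', hc', fun y => by simpa using hz' y⟩
    · refine ⟨k, a * c, by positivity, fun y => ?_⟩
      have h1 := mul_le_mul_of_nonneg_left (hz y) ha
      have h2 := mul_nonneg hb (hz0' y)
      simp only [BoundedContinuousFunction.coe_add, BoundedContinuousFunction.coe_smul,
        Pi.add_apply, smul_eq_mul]
      linarith
  have hJC : ∀ x, J x ∈ C := fun x => ⟨x, 1, one_pos, fun y => by rw [hJ, one_mul]⟩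
  have hJle : ∀ x x', dist (J x) (J x') ≤ dist x x' := by
    intro x x'
    rw [BoundedContinuousFunction.dist_le dist_nonneg]
    intro y
    rw [hJ, hJ, Real.dist_eq]
    refine (abs_min_sub_min_le_max _ _ _ _).trans ?_
    simp only [sub_self, abs_zero]
    exact max_le (abs_dist_sub_le _ _ _) dist_nonneg
  have hJcont : Continuous J := by
    refine (LipschitzWith.of_dist_le_mul (K := 1) ?_).continuous
    intro x x'; simpa using hJle x x'
  let j : P → C := fun x => ⟨J x, hJC x⟩
  have hjc : Continuous j := hJcont.subtype_mk _
  -- key estimate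
  have hkey : ∀ (z : C) (k : P) (c : ℝ), 0 < c → (∀ y, c * min (dist k y) 1 ≤ (z : P →ᵇ ℝ) y) →
      ∀ ε, 0 < ε → ε ≤ 1 → ∀ x, dist z (j x) < c * ε → dist x k < ε := by
    intro z k c hc hz ε hε hε1 x hx
    have h1 : dist ((z : P →ᵇ ℝ) x) (J x x) ≤ dist (z : P →ᵇ ℝ) (J x) :=
      BoundedContinuousFunction.dist_coe_le_dist x
    rw [hJ, dist_self, Real.dist_eq] at h1
    have h2 : c * min (dist k x) 1 < c * ε := by
      refine ((hz x).trans ?_).trans_lt (lt_of_le_of_lt h1 hx)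
      simpa using le_abs_self ((z : P →ᵇ ℝ) x)
    have h3 := lt_of_mul_lt_mul_left h2 hc.le
    rw [dist_comm]
    rcases min_lt_iff.1 h3 with h | h
    · exact h
    · linarith
  have hjemb : IsClosedEmbedding j := by
    refine IsClosedEmbedding.mk ?_ ?_
    · have hind : IsInducing j := by
        refine ⟨le_antisymm (continuous_iff_le_induced.1 hjc) ?_⟩
        rw [← continuous_id_iff_le]
        let τ : TopologicalSpace P := inferInstance
        rw [@continuous_iff_continuousAt]
        intro k
        unfold ContinuousAt
        rw [Metric.tendsto_nhds]
        intro ε hε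
        rw [nhds_induced]
        refine Filter.mem_comap.2 ⟨Metric.ball (j k) (min ε 1), Metric.ball_mem_nhds _ (by positivity), ?_⟩
        intro x hx
        have := hkey (j k) k 1 one_pos (fun y => by rw [one_mul]; exact le_rfl) (min ε 1)
          (by positivity) (min_le_right _ _) x (by rw [dist_comm, one_mul]; exact hx)
        exact lt_of_lt_of_le this (min_le_left _ _)
      exact hind.isEmbedding
    · rw [← closure_subset_iff_isClosed]
      intro z hz
      obtain ⟨k, c, hc, hk⟩ := z.2
      refine ⟨k, ?_⟩
      by_contra hne
      have hd : 0 < dist z (j k) := dist_pos.2 (Ne.symm hne)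
      set D := dist z (j k)
      obtain ⟨_, ⟨x, rfl⟩, hx⟩ := Metric.mem_closure_iff.1 hz (min (c * (min (D/2) 1)) (D/2))
        (by positivity)
      have h1 := hkey z k c hc hk (min (D/2) 1) (by positivity) (min_le_right _ _) x
        (lt_of_lt_of_le hx (min_le_left _ _))
      have h2 : dist (j x) (j k) ≤ dist x k := hJle x k
      have h3 : D ≤ dist z (j x) + dist (j x) (j k) := dist_triangle _ _ _
      have h4 := lt_of_lt_of_le hx (min_le_right _ _)
      have h5 := lt_of_lt_of_le h1 (min_le_left _ _)
      linarith
  have hi : IsClosedEmbedding (fun x => (π x, j x)) := by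
    let : MetricSpace B0 := metrizableSpaceMetric B0
    refine IsClosedEmbedding.mk ?_ ?_
    · refine IsEmbedding.of_comp (hπ.prodMk hjc) continuous_snd ?_
      exact hjemb.isEmbedding
    · have : range (fun x => (π x, j x)) =
          {q : B0 × (range j) | q.1 = π (hjemb.isEmbedding.toHomeomorph.symm q.2)}.image
            (fun q => (q.1, (q.2 : C))) := by
        ext ⟨b, z⟩
        constructor
        · rintro ⟨x, hx⟩
          simp only [Prod.mk.injEq] at hx
          obtain ⟨rfl, rfl⟩ := hx
          refine ⟨(π x, ⟨j x, x, rfl⟩), ?_, rfl⟩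
          show π x = π _
          congr 1
          rw [eq_comm, Homeomorph.symm_apply_eq]
          rfl
        · rintro ⟨⟨b', ⟨_, x, rfl⟩⟩, h, h'⟩
          simp only [Prod.mk.injEq] at h'
          obtain ⟨rfl, rfl⟩ := h'
          refine ⟨x, ?_⟩
          have : b' = π x := by
            refine (show b' = _ from h).trans ?_
            congr 1
            rw [Homeomorph.symm_apply_eq]
            rfl
          simp [this]
      rw [this]
      have hce : IsClosedEmbedding (fun q : B0 × (range j) => (q.1, (q.2 : C))) :=
        IsClosedEmbedding.id.prodMap hjemb.isClosed_range.isClosedEmbedding_subtypeVal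
      apply hce.isClosedMap
      exact isClosed_eq continuous_fst
        (hπ.comp (hjemb.isEmbedding.toHomeomorph.symm.continuous.comp continuous_snd))
  obtain ⟨U, hU, r, hr, hrr, hrπ, hrid⟩ := hret (B0 × C) inferInstance inferInstance Prod.fst
    continuous_fst _ hi (fun _ => rfl)
  let e := hi.isEmbedding.toHomeomorph
  have he : ∀ q, (π (e.symm q), j (e.symm q)) = (q : B0 × C) := fun q =>
    congrArg Subtype.val (e.apply_symm_apply q)
  have hUs : range (fun x => (π x, j x)) ⊆ interior U := subset_interior_iff_mem_nhdsSet.2 hU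
  refine ⟨C, j, interior U, fun u => e.symm ⟨r ⟨u, interior_subset u.2⟩, hrr _⟩, hC, hjc,
    isOpen_interior, fun x => hUs ⟨x, rfl⟩, ?_, ?_, ?_⟩
  · exact e.symm.continuous.comp ((hr.comp (continuous_subtype_val.subtype_mk _)).subtype_mk _)
  · intro u
    have := congrArg Prod.fst (he ⟨r ⟨u, interior_subset u.2⟩, hrr _⟩)
    exact this.trans (hrπ _)
  · intro x h
    dsimp only
    rw [Homeomorph.symm_apply_eq]
    apply Subtype.ext
    exact hrid _ ⟨x, rfl⟩

theorem aux_ane {B0 P : Type u} [TopologicalSpace B0] [MetrizableSpace B0] [TopologicalSpace P]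
    {π : P → B0} (hP : IsFiberANR B0 P π) : IsFiberANE B0 P π := by
  obtain ⟨C, j, U, r, hC, hj, hU, hjU, hr, hrπ, hrid⟩ := aux_pkg hP
  refine ⟨hP.1, hP.2.1, ?_⟩
  intro X _ _ πX hπX A hA f hf hfπ
  rcases A.eq_empty_or_nonempty with rfl | hne
  · refine ⟨∅, by simp, fun u => u.2.elim, ?_, fun u => u.2.elim, fun a ha => ha.elim⟩
    rw [continuous_iff_continuousAt]
    exact fun u => u.2.elim
  let : MetricSpace X := metrizableSpaceMetric X
  obtain ⟨F, hF, hFC, hFf⟩ := aux_dugundji hA hne C hC (fun a => (j (f a)).1)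
    (continuous_subtype_val.comp (hj.comp hf)) (fun a => (j (f a)).2)
  let Φ : X → B0 × C := fun x => (πX x, ⟨F x, hFC x⟩)
  have hΦ : Continuous Φ := hπX.prodMk (hF.subtype_mk _)
  have hΦA : ∀ a : A, Φ a = (π (f a), j (f a)) := fun a =>
    Prod.ext (hfπ a).symm (Subtype.ext (hFf a))
  refine ⟨Φ ⁻¹' U, ?_, fun u => r ⟨Φ u, u.2⟩, ?_, fun u => hrπ _, ?_⟩
  · refine (hU.preimage hΦ).mem_nhdsSet.2 ?_
    intro a ha
    show Φ a ∈ U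
    rw [hΦA ⟨a, ha⟩]; exact hjU _
  · exact hr.comp ((hΦ.comp continuous_subtype_val).subtype_mk _)
  · intro a ha hu
    have h1 := hrid (f ⟨a, ha⟩) (hjU _)
    rw [← h1]
    dsimp only
    congr 1
    exact Subtype.ext (hΦA ⟨a, ha⟩)

theorem aux_equi {B0 P : Type u} [TopologicalSpace B0] [MetrizableSpace B0] [TopologicalSpace P]
    {π : P → B0} (hP : IsFiberANR B0 P π) :
    ∃ W : Set (P × P), IsOpen W ∧ (∀ x, (x, x) ∈ W) ∧ ∃ L : W × unitInterval → P, Continuous L ∧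
      (∀ w t, π (L (w, t)) = π w.1.1) ∧ (∀ w, L (w, 0) = w.1.1) ∧
      (∀ w, π w.1.1 = π w.1.2 → L (w, 1) = w.1.2) := by
  obtain ⟨C, j, U, r, hC, hj, hU, hjU, hr, hrπ, hrid⟩ := aux_pkg hP
  have hπ := hP.2.1
  let Φ : (P × P) × unitInterval → B0 × C := fun q => (π q.1.1,
    ⟨(1 - (q.2 : ℝ)) • (j q.1.1).1 + (q.2 : ℝ) • (j q.1.2).1,
      hC (j q.1.1).2 (j q.1.2).2 (by linarith [q.2.2.2]) q.2.2.1 (by ring)⟩)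
  have hΦ : Continuous Φ := by
    refine (by fun_prop : Continuous fun q : (P × P) × unitInterval => π q.1.1).prodMk
      (Continuous.subtype_mk ?_ _)
    fun_prop
  let W : Set (P × P) := {w | ∀ t, Φ (w, t) ∈ U}
  have hW : IsOpen W := by
    rw [isOpen_iff_eventually]
    intro w hw
    have := isCompact_univ.eventually_forall_of_forall_eventually (x₀ := w) (K := univ)
      (P := fun w (t : unitInterval) => Φ (w, t) ∈ U)
      (fun t _ => hΦ.continuousAt.eventually_mem (hU.mem_nhds (hw t)))
    exact this.mono fun w hw t => hw t (mem_univ t)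
  refine ⟨W, hW, ?_, fun q => r ⟨Φ (q.1.1, q.2), q.1.2 q.2⟩, ?_, fun w t => hrπ _, ?_, ?_⟩
  · intro x t
    have : Φ ((x, x), t) = (π x, j x) := by
      refine Prod.ext rfl (Subtype.ext ?_)
      show (1 - (t : ℝ)) • (j x).1 + (t : ℝ) • (j x).1 = _
      rw [← add_smul]; simp
    rw [this]; exact hjU x
  · exact hr.comp ((hΦ.comp (by fun_prop)).subtype_mk _)
  · intro w
    rw [← hrid w.1.1 (hjU _)]
    dsimp only
    congr 1
    refine Subtype.ext (Prod.ext ?_ (Subtype.ext ?_))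
    · simp [Φ]
    · simp [Φ]
  · intro w hw
    have := hrid w.1.2 (hjU _)
    refine Eq.trans ?_ this
    dsimp only
    congr 1
    refine Subtype.ext (Prod.ext ?_ (Subtype.ext ?_))
    · simp [Φ, hw]
    · simp [Φ]

abbrev AuxPath {B0 P : Type u} [TopologicalSpace P] (π : P → B0) : Type u :=
  {ω : C(unitInterval, P) // ∀ t, π (ω t) = π (ω 0)}

theorem aux_path {B0 P : Type u} [TopologicalSpace B0] [MetrizableSpace B0] [TopologicalSpace P]
    {π : P → B0} (hP : IsFiberANR B0 P π) :
    IsFiberANR B0 {ω : C(unitInterval, P) // ∀ t, π (ω t) = π (ω 0)} (fun ω => π (ω.1 0)) := by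
  have hE := aux_ane hP
  obtain ⟨hM, hπ, -⟩ := hP
  refine ⟨?_, ?_, ?_⟩
  · let : MetricSpace P := metrizableSpaceMetric P
    infer_instance
  · fun_prop
  intro Z _ _ πZ hπZ i hi hiπ
  let e := hi.isEmbedding.toHomeomorph
  have he : ∀ q, i (e.symm q) = q := fun q => congrArg Subtype.val (e.apply_symm_apply q)
  have he' : ∀ ω (h : i ω ∈ range i), e.symm ⟨i ω, h⟩ = ω := fun ω h => by
    rw [Homeomorph.symm_apply_eq]; rfl
  let A : Set (Z × unitInterval) := {q | q.1 ∈ range i}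
  have hA : IsClosed A := hi.isClosed_range.preimage continuous_fst
  let f : A → P := fun q => (e.symm ⟨q.1.1, q.2⟩).1 q.1.2
  have hf : Continuous f := by
    have h1 : Continuous fun q : A => (e.symm ⟨q.1.1, q.2⟩).1 :=
      continuous_subtype_val.comp (e.symm.continuous.comp
        ((continuous_fst.comp continuous_subtype_val).subtype_mk _))
    exact h1.eval (continuous_snd.comp continuous_subtype_val)
  obtain ⟨V, hV, g, hg, hgπ, hgf⟩ := hE.2.2 (Z × unitInterval) inferInstance inferInstance
    (fun q => πZ q.1) (hπZ.comp continuous_fst) A hA f hf (fun q => by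
      rw [(e.symm ⟨q.1.1, q.2⟩).2]
      exact (hiπ _).symm.trans (congrArg πZ (he _)))
  have hAV : A ⊆ interior V := subset_interior_iff_mem_nhdsSet.2 hV
  let U : Set Z := {z | ∀ t : unitInterval, (z, t) ∈ interior V}
  have hU : IsOpen U := by
    rw [isOpen_iff_eventually]
    intro w hw
    have := isCompact_univ.eventually_forall_of_forall_eventually (x₀ := w) (K := univ)
      (P := fun w (t : unitInterval) => (w, t) ∈ interior V)
      (fun t _ => isOpen_interior.mem_nhds (hw t))
    exact this.mono fun w hw t => hw t (mem_univ t)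
  let g' : C(U × unitInterval, P) := ⟨fun q => g ⟨(q.1.1, q.2), interior_subset (q.1.2 q.2)⟩,
    hg.comp (Continuous.subtype_mk (by fun_prop) _)⟩
  have hg'π : ∀ z t, π (g'.curry z t) = πZ z := fun z t => hgπ _
  refine ⟨U, hU.mem_nhdsSet.2 ?_, fun z => i ⟨g'.curry z, fun t => by rw [hg'π, hg'π]⟩, ?_,
    fun z => ⟨_, rfl⟩, ?_, ?_⟩
  · intro z hz t
    exact hAV hz
  · exact hi.continuous.comp (g'.curry.continuous.subtype_mk _)
  · intro z
    rw [hiπ]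
    exact hg'π z 0
  · rintro ⟨_, hz⟩ ⟨ω, rfl⟩
    dsimp only
    congr 1
    refine Subtype.ext (ContinuousMap.ext fun t => ?_)
    have := hgf (i ω, t) ⟨ω, rfl⟩ (interior_subset (hz t))
    refine this.trans ?_
    show (e.symm ⟨i ω, _⟩).1 t = _
    rw [he']

theorem aux_cover {P : Type u} [TopologicalSpace P] {W : Set (P × P)} (hW : IsOpen W)
    (hd : ∀ x, (x, x) ∈ W) :
    IsOpenCover {V : Set P | IsOpen V ∧ ∀ x ∈ V, ∀ y ∈ V, (x, y) ∈ W} := by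
  refine ⟨fun V hV => hV.1, eq_univ_of_forall fun x => ?_⟩
  obtain ⟨u, v, hu, hv, hxu, hxv, huv⟩ := isOpen_prod_iff.1 hW x x (hd x)
  exact ⟨u ∩ v, ⟨hu.inter hv, fun a ha b hb => huv ⟨ha.1, hb.2⟩⟩, hxu, hxv⟩

theorem aux_E1 {B0 : Type u} [TopologicalSpace B0] [MetrizableSpace B0]
    {X : Type u} [TopologicalSpace X] {πX : X → B0}
    {S : FibInvSys B0} {p : FibMapToSys X πX S} (hres : IsFibResolution X πX S p) :
    CondE1 X πX S p := by
  intro P _ πP hP f hf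
  obtain ⟨W, hW, hd, L, hL, hLπ, hL0, hL1⟩ := aux_equi hP
  obtain ⟨a, h, hh, hn⟩ := hres.1 P _ πP hP _ (aux_cover hW hd) f hf
  have hw : ∀ x, (h (p.maps a x), f x) ∈ W := fun x => by
    obtain ⟨V, hV, h1, h2⟩ := hn x
    exact hV.2 _ h2 _ h1
  have hfp : ∀ x, πP (h (p.maps a x)) = πX x := fun x => by rw [hh.2, p.fp]
  refine ⟨a, h, hh, fun q => L (⟨_, hw q.1⟩, q.2), ?_, fun x => hL0 _, fun x => hL1 _ ?_,
    fun x t => (hLπ _ _).trans (hfp x)⟩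
  · have h1 := hh.1
    have h2 := hf.1
    have h3 := p.cont a
    exact hL.comp (Continuous.prodMk (Continuous.subtype_mk (by fun_prop) _) continuous_snd)
  · exact (hfp x).trans (hf.2 x).symm

theorem aux_SE2 {B0 : Type u} [TopologicalSpace B0] [MetrizableSpace B0]
    {X : Type u} [TopologicalSpace X] {πX : X → B0}
    {S : FibInvSys B0} {p : FibMapToSys X πX S} (hres : IsFibResolution X πX S p) :
    CondSE2 X πX S p := by
  intro P _ πP hP a f0 f1 hf0 hf1 Sh hSh hShπ hSh0 hSh1
  obtain ⟨W, hW, hd, L, hL, hLπ, hL0, hL1⟩ := aux_equi hP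
  obtain ⟨U', hU', hR2⟩ := hres.2 P _ πP hP _ (aux_cover hW hd)
  have hU'c : ∀ x, ∃ V ∈ U', x ∈ V := fun x => by
    have : x ∈ ⋃₀ U' := by rw [hU'.2]; trivial
    exact this
  have hQ := aux_path hP
  have hv : Continuous fun ω : (AuxPath πP) => ω.1 := continuous_subtype_val
  let 𝒪 : Set (Set (AuxPath πP)) := {O | IsOpen O ∧ (∃ V ∈ U', ∀ ω ∈ O, ω.1 0 ∈ V) ∧
    (∃ V ∈ U', ∀ ω ∈ O, ω.1 1 ∈ V) ∧ ∀ ω ∈ O, ∀ ω' ∈ O, ∀ t, (ω.1 t, ω'.1 t) ∈ W}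
  have h𝒪 : IsOpenCover 𝒪 := by
    refine ⟨fun V hV => hV.1, eq_univ_of_forall fun ω => ?_⟩
    obtain ⟨V0, hV0, hω0⟩ := hU'c (ω.1 0)
    obtain ⟨V1, hV1, hω1⟩ := hU'c (ω.1 1)
    let WQ : Set ((AuxPath πP) × (AuxPath πP)) := {q | ∀ t, (q.1.1 t, q.2.1 t) ∈ W}
    have hWQ : IsOpen WQ := by
      rw [isOpen_iff_eventually]
      intro w hw
      have hc : Continuous fun q : ((AuxPath πP) × (AuxPath πP)) × unitInterval => (q.1.1.1 q.2, q.1.2.1 q.2) :=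
        ((hv.comp (continuous_fst.comp continuous_fst)).eval continuous_snd).prodMk
          ((hv.comp (continuous_snd.comp continuous_fst)).eval continuous_snd)
      have := isCompact_univ.eventually_forall_of_forall_eventually (x₀ := w) (K := univ)
        (P := fun (q : (AuxPath πP) × (AuxPath πP)) (t : unitInterval) => (q.1.1 t, q.2.1 t) ∈ W)
        (fun t _ => hc.continuousAt.eventually_mem (hW.mem_nhds (hw t)))
      exact this.mono fun w hw t => hw t (mem_univ t)
    obtain ⟨O, ⟨hO, hOW⟩, hωO⟩ : ∃ O, (IsOpen O ∧ ∀ x ∈ O, ∀ y ∈ O, (x, y) ∈ WQ) ∧ ω ∈ O := by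
      have := (aux_cover hWQ (fun x t => hd _)).2
      exact Set.mem_sUnion.1 (this ▸ mem_univ ω)
    refine ⟨O ∩ ((fun ω : (AuxPath πP) => ω.1 0) ⁻¹' V0 ∩ (fun ω : (AuxPath πP) => ω.1 1) ⁻¹' V1),
      ⟨hO.inter (((hU'.1 _ hV0).preimage (hv.eval continuous_const)).inter
        ((hU'.1 _ hV1).preimage (hv.eval continuous_const))), ⟨V0, hV0, fun ω h => h.2.1⟩,
        ⟨V1, hV1, fun ω h => h.2.2⟩, fun ω h ω' h' => hOW ω h.1 ω' h'.1⟩, hωO, hω0, hω1⟩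
  let sg : X → (AuxPath πP) := fun x => ⟨(⟨Sh, hSh⟩ : C(X × unitInterval, P)).curry x, fun t => by
    show πP (Sh (x, t)) = πP (Sh (x, 0))
    rw [hShπ, hShπ]⟩
  have hsg : Continuous sg :=
    ((⟨Sh, hSh⟩ : C(X × unitInterval, P)).curry.continuous).subtype_mk _
  obtain ⟨a1, f, hf, hn⟩ := hres.1 (AuxPath πP) _ _ hQ 𝒪 h𝒪 sg ⟨hsg, fun x => hShπ x 0⟩
  clear hv
  have hfπ : ∀ y t, πP ((f y).1 t) = S.proj a1 y := fun y t => ((f y).2 t).trans (hf.2 y)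
  obtain ⟨c, hac, ha1c⟩ := S.directed a a1
  have hfc := hf.1
  have hf0c := hf0.1
  have hf1c := hf1.1
  have hb := S.bond_cont
  have hfx : ∀ c (h : S.le a1 c) x, f (S.bond a1 c h (p.maps c x)) = f (p.maps a1 x) := by
    intro c h x; rw [p.comm]
  obtain ⟨c1, hcc1, hn1⟩ := hR2 c (fun z => f0 (S.bond a c hac z))
    (fun z => (f (S.bond a1 c ha1c z)).1 0)
    ⟨hf0c.comp (hb _ _ _), fun z => by rw [hf0.2, S.bond_fp]⟩
    ⟨by
      have := hfc.comp (hb _ _ ha1c)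
      exact (continuous_subtype_val.comp this).eval continuous_const,
     fun z => (hfπ _ _).trans (S.bond_fp _ _ _ _)⟩
    (fun x => by
      obtain ⟨O, hO, h1, h2⟩ := hn x
      obtain ⟨V, hV, hOV⟩ := hO.2.1
      refine ⟨V, hV, ?_, ?_⟩
      · dsimp only
        rw [p.comm, ← hSh0]; exact hOV _ h1
      · dsimp only
        rw [p.comm]; exact hOV _ h2)
  obtain ⟨d, hc1d, hn2⟩ := hR2 c1 (fun z => f1 (S.bond a c hac (S.bond c c1 hcc1 z)))
    (fun z => (f (S.bond a1 c ha1c (S.bond c c1 hcc1 z))).1 1)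
    ⟨hf1c.comp ((hb _ _ _).comp (hb _ _ _)), fun z => by rw [hf1.2, S.bond_fp, S.bond_fp]⟩
    ⟨by
      have := hfc.comp ((hb _ _ ha1c).comp (hb _ _ hcc1))
      exact (continuous_subtype_val.comp this).eval continuous_const,
     fun z => (hfπ _ _).trans ((S.bond_fp _ _ _ _).trans (S.bond_fp _ _ _ _))⟩
    (fun x => by
      obtain ⟨O, hO, h1, h2⟩ := hn x
      obtain ⟨V, hV, hOV⟩ := hO.2.2.1
      refine ⟨V, hV, ?_, ?_⟩
      · dsimp only
        rw [p.comm, p.comm, ← hSh1]; exact hOV _ h1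
      · dsimp only
        rw [p.comm, p.comm]; exact hOV _ h2)
  have had : S.le a d := S.le_trans _ _ _ hac (S.le_trans _ _ _ hcc1 hc1d)
  have ha1d : S.le a1 d := S.le_trans _ _ _ ha1c (S.le_trans _ _ _ hcc1 hc1d)
  let F : S.obj d → (AuxPath πP) := fun z => f (S.bond a1 d ha1d z)
  have hF : Continuous F := hfc.comp (hb _ _ _)
  have hFπ : ∀ z t, πP ((F z).1 t) = S.proj d z := fun z t =>
    (hfπ _ _).trans (S.bond_fp _ _ _ _)
  let e0 : S.obj d → P := fun z => f0 (S.bond a d had z)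
  let e1 : S.obj d → P := fun z => f1 (S.bond a d had z)
  have he0 : Continuous e0 := hf0c.comp (hb _ _ _)
  have he1 : Continuous e1 := hf1c.comp (hb _ _ _)
  have he0π : ∀ z, πP (e0 z) = S.proj d z := fun z => by rw [hf0.2, S.bond_fp]
  have he1π : ∀ z, πP (e1 z) = S.proj d z := fun z => by rw [hf1.2, S.bond_fp]
  have hw0 : ∀ z, (e0 z, (F z).1 0) ∈ W := fun z => by
    obtain ⟨V, hV, h1, h2⟩ := hn1 (S.bond c1 d hc1d z)
    have := hV.2 _ h1 _ h2
    simpa only [S.bond_comp] using this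
  have hw1 : ∀ z, (e1 z, (F z).1 1) ∈ W := fun z => by
    obtain ⟨V, hV, h1, h2⟩ := hn2 z
    have := hV.2 _ h1 _ h2
    simpa only [S.bond_comp] using this
  have hwS : ∀ x t, (Sh (x, t), (F (p.maps d x)).1 t) ∈ W := fun x t => by
    obtain ⟨O, hO, h1, h2⟩ := hn x
    have : F (p.maps d x) = f (p.maps a1 x) := hfx _ _ _
    rw [this]
    exact hO.2.2.2 _ h1 _ h2 t
  have hpe0 : ∀ x, e0 (p.maps d x) = Sh (x, 0) := fun x => by
    show f0 (S.bond a d had _) = _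
    rw [p.comm, hSh0]
  have hpe1 : ∀ x, e1 (p.maps d x) = Sh (x, 1) := fun x => by
    show f1 (S.bond a d had _) = _
    rw [p.comm, hSh1]
  let pr : ℝ → unitInterval := Set.projIcc 0 1 zero_le_one
  have hpr : Continuous pr := continuous_projIcc
  have pr0 : ∀ s, s ≤ 0 → pr s = 0 := fun s hs => Set.projIcc_of_le_left _ hs
  have pr1 : ∀ s, 1 ≤ s → pr s = 1 := fun s hs => Set.projIcc_of_right_le _ hs
  let H0 : S.obj d × unitInterval → P := fun q =>
    L (⟨_, hw0 q.1⟩, pr (3 * (q.2 : ℝ)))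
  let Hm : S.obj d × unitInterval → P := fun q => (F q.1).1 (pr (3 * (q.2 : ℝ) - 1))
  let H1 : S.obj d × unitInterval → P := fun q =>
    L (⟨_, hw1 q.1⟩, pr (3 - 3 * (q.2 : ℝ)))
  have hFc : Continuous fun q : S.obj d × unitInterval => (F q.1).1 :=
    continuous_subtype_val.comp (hF.comp continuous_fst)
  have hH0 : Continuous H0 := hL.comp (Continuous.prodMk (Continuous.subtype_mk
    ((he0.comp continuous_fst).prodMk (hFc.eval continuous_const)) _) (by fun_prop))
  have hH1 : Continuous H1 := hL.comp (Continuous.prodMk (Continuous.subtype_mk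
    ((he1.comp continuous_fst).prodMk (hFc.eval continuous_const)) _) (by fun_prop))
  have hHm : Continuous Hm := hFc.eval (by fun_prop)
  let H : S.obj d × unitInterval → P := fun q =>
    if (q.2 : ℝ) ≤ 1 / 3 then H0 q else if (q.2 : ℝ) ≤ 2 / 3 then Hm q else H1 q
  have hHc : Continuous H := by
    refine Continuous.if_le hH0 (Continuous.if_le hHm hH1 (by fun_prop) continuous_const ?_)
      (by fun_prop) continuous_const ?_
    · intro q hq
      show (F q.1).1 (pr (3 * (q.2 : ℝ) - 1)) = L (⟨_, hw1 q.1⟩, pr (3 - 3 * (q.2 : ℝ)))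
      rw [pr1 _ (by rw [hq]; norm_num), pr1 _ (by rw [hq]; norm_num), hL1]
      exact (he1π _).trans (hFπ _ _).symm
    · intro q hq
      rw [if_pos (by rw [hq]; norm_num)]
      show L (⟨_, hw0 q.1⟩, pr (3 * (q.2 : ℝ))) = (F q.1).1 (pr (3 * (q.2 : ℝ) - 1))
      rw [pr0 (3 * (q.2 : ℝ) - 1) (by rw [hq]; norm_num),
        pr1 (3 * (q.2 : ℝ)) (by rw [hq]; norm_num), hL1]
      exact (he0π _).trans (hFπ _ _).symm
  have hH0' : ∀ q, (q.2 : ℝ) ≤ 1 / 3 → H q = H0 q := fun q hq => if_pos hq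
  have hHm' : ∀ q, ¬ (q.2 : ℝ) ≤ 1 / 3 → (q.2 : ℝ) ≤ 2 / 3 → H q = Hm q := fun q hq hq' =>
    (if_neg hq).trans (if_pos hq')
  have hH1' : ∀ q, ¬ (q.2 : ℝ) ≤ 1 / 3 → ¬ (q.2 : ℝ) ≤ 2 / 3 → H q = H1 q := fun q hq hq' =>
    (if_neg hq).trans (if_neg hq')
  let K : (X × unitInterval) × unitInterval → P := fun q => L (⟨_, hwS q.1.1 q.1.2⟩, q.2)
  have hpd := p.cont d
  have hK : Continuous K := by
    have hFc' : Continuous fun q : (X × unitInterval) × unitInterval => (F (p.maps d q.1.1)).1 :=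
      continuous_subtype_val.comp (hF.comp (by fun_prop))
    exact hL.comp (Continuous.prodMk (Continuous.subtype_mk
      ((hSh.comp (by fun_prop)).prodMk (hFc'.eval (by fun_prop))) _) (by fun_prop))
  have hK0 : ∀ x t, K ((x, t), 0) = Sh (x, t) := fun x t => hL0 _
  have hK1 : ∀ x t, K ((x, t), 1) = (F (p.maps d x)).1 t := fun x t =>
    hL1 _ ((hShπ _ _).trans (by rw [hFπ, p.fp]))
  refine ⟨d, had, H, hHc, ?_, ?_, ?_, ?_⟩
  · intro z t
    by_cases h1 : (t : ℝ) ≤ 1 / 3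
    · rw [hH0' _ h1]; exact (hLπ _ _).trans (he0π z)
    · by_cases h2 : (t : ℝ) ≤ 2 / 3
      · rw [hHm' _ h1 h2]; exact hFπ _ _
      · rw [hH1' _ h1 h2]; exact (hLπ _ _).trans (he1π z)
  · intro z
    rw [hH0' _ (by norm_num)]
    show L (⟨_, hw0 z⟩, pr (3 * ((0 : unitInterval) : ℝ))) = _
    rw [pr0 _ (by simp), hL0]
  · intro z
    rw [hH1' _ (by norm_num) (by norm_num)]
    show L (⟨_, hw1 z⟩, pr (3 - 3 * ((1 : unitInterval) : ℝ))) = _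
    rw [pr0 _ (by simp), hL0]
  · let uu : unitInterval → unitInterval → unitInterval := fun t s =>
      pr ((1 - (s : ℝ)) * t + s * (pr (3 * (t : ℝ) - 1) : ℝ))
    let vv : unitInterval → unitInterval → unitInterval := fun t s =>
      pr (s * min (3 * (t : ℝ)) (3 - 3 * t))
    have hprI : ∀ t : unitInterval, pr (t : ℝ) = t := fun t => Set.projIcc_val _ t
    refine ⟨fun q => K ((q.1.1, uu q.1.2 q.2), vv q.1.2 q.2), ?_, ?_, ?_, ?_, ?_, ?_⟩
    · exact hK.comp (by fun_prop)
    · rintro ⟨x, t⟩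
      have h1 : uu t 0 = t := by simp [uu, hprI]
      have h2 : vv t 0 = 0 := pr0 _ (by simp)
      simp only [h1, h2, hK0]
    · rintro ⟨x, t⟩
      have h1 : uu t 1 = pr (3 * (t : ℝ) - 1) := by simp [uu, hprI]
      have h2 : vv t 1 = pr (min (3 * (t : ℝ)) (3 - 3 * t)) := by simp [vv]
      simp only [h1, h2]
      by_cases ht1 : (t : ℝ) ≤ 1 / 3
      · rw [hH0' _ ht1, pr0 (3 * (t : ℝ) - 1) (by linarith), min_eq_left (by linarith)]
        show L (⟨_, _⟩, _) = L (⟨_, _⟩, _)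
        congr 3
        exact congrArg (fun y => (y, _)) (hpe0 x).symm
      · by_cases ht2 : (t : ℝ) ≤ 2 / 3
        · rw [hHm' _ ht1 ht2, pr1 (min _ _) (le_min (by linarith) (by linarith)), hK1]
        · rw [hH1' _ ht1 ht2, pr1 (3 * (t : ℝ) - 1) (by linarith), min_eq_right (by linarith)]
          show L (⟨_, _⟩, _) = L (⟨_, _⟩, _)
          congr 3
          exact congrArg (fun y => (y, _)) (hpe1 x).symm
    · intro z s
      exact (hLπ _ _).trans (hShπ _ _)
    · intro x s
      have h0 : pr (3 * ((0 : unitInterval) : ℝ) - 1) = 0 := pr0 _ (by simp)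
      have h1 : uu 0 s = 0 := pr0 _ (by rw [h0]; simp)
      have h2 : vv 0 s = 0 := pr0 _ (by simp)
      simp only [h1, h2, hK0]
    · intro x s
      have h0 : pr (3 * ((1 : unitInterval) : ℝ) - 1) = 1 := pr1 _ (by norm_num)
      have h1 : uu 1 s = 1 := pr1 _ (by rw [h0]; simp)
      have h2 : vv 1 s = 0 := pr0 _ (by simp)
      simp only [h1, h2, hK0]

/-- Theorem 1.5: every resolution over `B0` of a topological space `X` over `B0` is a strong
expansion over `B0`, i.e. it satisfies conditions (E1) and (SE2). -/
theorem fibResolution_isStrongExpansion (B0 : Type u) [TopologicalSpace B0] [MetrizableSpace B0]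
    (X : Type u) [TopologicalSpace X] (πX : X → B0) (hπX : Continuous πX)
    (S : FibInvSys B0) (p : FibMapToSys X πX S) (hres : IsFibResolution X πX S p) :
    IsFibStrongExpansion X πX S p := by
  exact ⟨aux_E1 hres, aux_SE2 hres⟩
end

section
/- Every topological space X over B0 admits a cofinite strong ANR_{B0}-expansion: there exist an inverse system X = (X_α, p_{αα'}, 𝒜) in Top_{B0} over a cofinite directed set 𝒜, with every X_α an ANR_{B0}-space, and a morphism p : X → X which is a strong expansion over B0. -/
open Set Topology TopologicalSpace unitInterval

universe u

/-- Dugundji extension theorem. -/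
theorem dugundji_ext {Z E : Type u} [TopologicalSpace Z] [MetrizableSpace Z]
    [NormedAddCommGroup E] [NormedSpace ℝ E] (A : Set Z) (hA : IsClosed A) (f : A → E)
    (hf : Continuous f) : ∃ g : Z → E, Continuous g ∧ ∀ a : A, g a = f a := by
  classical
  let := metrizableSpaceMetric Z
  rcases A.eq_empty_or_nonempty with rfl | hne
  · exact ⟨fun _ => 0, continuous_const, fun a => a.2.elim⟩
  let t : (Aᶜ : Set Z) → Set E := fun z =>
    convexHull ℝ (f '' {a : A | dist (z : Z) a < 2 * Metric.infDist (z : Z) A})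
  obtain ⟨h, hh⟩ := exists_continuous_forall_mem_convex_of_local_const (t := t)
    (fun z => convex_convexHull _ _) (by
      intro z
      have hpos : 0 < Metric.infDist (z : Z) A := (hA.notMem_iff_infDist_pos hne).1 z.2
      obtain ⟨a, ha, hda⟩ := (Metric.infDist_lt_iff (r := 2 * Metric.infDist (z : Z) A) hne).1
        (by linarith)
      refine ⟨f ⟨a, ha⟩, ?_⟩
      have h1 : Continuous fun y : (Aᶜ : Set Z) => dist (y : Z) a := by fun_prop
      have h2 : Continuous fun y : (Aᶜ : Set Z) => 2 * Metric.infDist (y : Z) A :=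
        continuous_const.mul ((Metric.continuous_infDist_pt A).comp continuous_subtype_val)
      filter_upwards [(isOpen_lt h1 h2).mem_nhds hda] with y hy
      exact subset_convexHull _ _ ⟨⟨a, ha⟩, hy, rfl⟩)
  let g : Z → E := fun z => if hz : z ∈ A then f ⟨z, hz⟩ else h ⟨z, hz⟩
  have hgA : ∀ a : A, g a = f a := fun a => by simp [g]
  refine ⟨g, ?_, hgA⟩
  rw [continuous_iff_continuousAt]
  intro z
  by_cases hz : z ∈ A
  · rw [Metric.continuousAt_iff]
    intro ε hε
    obtain ⟨δ, hδ, hfδ⟩ := Metric.continuousAt_iff.1 (hf.continuousAt (x := ⟨z, hz⟩)) ε hε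
    refine ⟨δ / 3, by positivity, ?_⟩
    intro y hy
    have hgz : g z = f ⟨z, hz⟩ := hgA ⟨z, hz⟩
    rw [hgz]
    by_cases hyA : y ∈ A
    · have hgy : g y = f ⟨y, hyA⟩ := hgA ⟨y, hyA⟩
      rw [hgy]
      apply hfδ
      have : dist y z < δ := by linarith
      exact this
    · have hgy : g y = h ⟨y, hyA⟩ := by simp [g, hyA]
      rw [hgy, ← Metric.mem_ball]
      refine convexHull_min ?_ (convex_ball (f ⟨z, hz⟩) ε) (hh ⟨y, hyA⟩)
      rintro _ ⟨a, ha, rfl⟩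
      apply hfδ
      have h1 : dist y (a : Z) < 2 * Metric.infDist y A := ha
      have h2 : Metric.infDist y A ≤ dist y z := Metric.infDist_le_dist_of_mem hz
      have h3 : dist (a : Z) z ≤ dist y a + dist y z := dist_triangle_left _ _ _
      have : dist (a : Z) z < δ := by linarith
      exact this
  · have ho : IsOpen (Aᶜ : Set Z) := hA.isOpen_compl
    have hr : ContinuousOn g Aᶜ := by
      rw [continuousOn_iff_continuous_domRestrict]
      convert h.continuous using 1
      ext y
      have : (y : Z) ∉ A := y.2
      simp [g, this]
    exact hr.continuousAt (ho.mem_nhds hz)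

/-- Arens–Eells: closed embedding of a metrizable space in a normed space. -/
theorem arens_eells (P : Type u) [TopologicalSpace P] [MetrizableSpace P] :
    ∃ (L : Type u) (_ : NormedAddCommGroup L) (_ : NormedSpace ℝ L) (j : P → L),
      IsClosedEmbedding j := by
  classical
  let := metrizableSpaceMetric P
  let : TopologicalSpace (Finset P) := ⊥
  have : DiscreteTopology (Finset P) := ⟨rfl⟩
  let J : P → BoundedContinuousFunction (Finset P) ℝ := fun p =>
    BoundedContinuousFunction.ofNormedAddCommGroupDiscrete
      (fun D => min (Metric.infDist p (D : Set P)) 1) 1 (fun D => by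
        rw [Real.norm_eq_abs, abs_of_nonneg (le_min Metric.infDist_nonneg zero_le_one)]
        exact min_le_right _ _)
  have hJ : ∀ p D, J p D = min (Metric.infDist p (D : Set P)) 1 := fun p D => rfl
  have hJc : Continuous J := by
    refine (LipschitzWith.of_dist_le_mul (K := 1) fun p q => ?_).continuous
    rw [NNReal.coe_one, one_mul, BoundedContinuousFunction.dist_le dist_nonneg]
    intro D
    rw [hJ, hJ, Real.dist_eq]
    refine (abs_min_sub_min_le_max _ _ _ _).trans ?_
    simp only [sub_self, abs_zero, max_le_iff, dist_nonneg, and_true]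
    rw [abs_sub_le_iff]
    constructor
    · linarith [Metric.infDist_le_infDist_add_dist (x := p) (y := q) (s := (D : Set P))]
    · linarith [Metric.infDist_le_infDist_add_dist (x := q) (y := p) (s := (D : Set P)),
        dist_comm p q]
  let L := Submodule.span ℝ (Set.range J)
  let j : P → L := fun p => ⟨J p, Submodule.subset_span ⟨p, rfl⟩⟩
  have hjc : Continuous j := hJc.subtype_mk _
  refine ⟨L, inferInstance, inferInstance, j, ?_⟩
  apply IsClosedEmbedding.of_continuous_injective_isClosedMap hjc
  · intro p q hpq
    have h1 : J p = J q := congrArg Subtype.val hpq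
    have h2 : J p {q} = J q {q} := by rw [h1]
    rw [hJ, hJ] at h2
    simp only [Finset.coe_singleton, Metric.infDist_singleton, dist_self] at h2
    have h3 : dist p q ≤ 0 := by
      by_contra hc
      push Not at hc
      have := lt_min hc one_pos
      rw [h2] at this
      simp at this
    exact dist_le_zero.1 h3
  · intro C hC
    rw [← closure_subset_iff_isClosed]
    intro g hg
    obtain ⟨y, hyC, hy⟩ := mem_closure_iff_seq_limit.1 hg
    choose q hqC hq using hyC
    obtain ⟨c, hc⟩ := Finsupp.mem_span_range_iff_exists_finsupp.1 g.2
    let D : Finset P := insert (q 0) c.support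
    have hDne : (D : Set P).Nonempty := ⟨q 0, by simp [D]⟩
    have hgD : (g : BoundedContinuousFunction (Finset P) ℝ) D = 0 := by
      rw [← hc, Finsupp.sum, BoundedContinuousFunction.coe_sum, Finset.sum_apply]
      apply Finset.sum_eq_zero
      intro p hp
      have hpD : p ∈ (D : Set P) := by
        simp only [D, Finset.coe_insert]; exact Or.inr hp
      simp [hJ, Metric.infDist_zero_of_mem hpD]
    have hlim : Filter.Tendsto (fun n => J (q n) D) Filter.atTop (𝓝 0) := by
      rw [← hgD]
      have h1 : Continuous fun l : L => (l : BoundedContinuousFunction (Finset P) ℝ) D :=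
        (continuous_eval_const D).comp continuous_subtype_val
      have h2 := (h1.tendsto g).comp hy
      refine h2.congr fun n => ?_
      simp [← hq n, j]
    have hinf : Filter.Tendsto (fun n => Metric.infDist (q n) (D : Set P)) Filter.atTop (𝓝 0) := by
      refine hlim.congr' ?_
      filter_upwards [hlim.eventually (gt_mem_nhds one_pos)] with n hn
      rw [hJ] at hn ⊢
      rcases min_lt_iff.1 hn with h | h
      · exact min_eq_left h.le
      · exact absurd h (lt_irrefl _)
    have hDc : IsCompact (D : Set P) := D.finite_toSet.isCompact
    choose p hpD hp using fun n => hDc.exists_infDist_eq_dist hDne (q n)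
    obtain ⟨p0, -, φ, hφ, hlimp⟩ := hDc.tendsto_subseq hpD
    have hq0 : Filter.Tendsto (q ∘ φ) Filter.atTop (𝓝 p0) := by
      have h1 := hinf.comp hφ.tendsto_atTop
      rw [tendsto_iff_dist_tendsto_zero] at hlimp ⊢
      have h2 := h1.add hlimp
      rw [add_zero] at h2
      refine squeeze_zero (fun _ => dist_nonneg) (fun n => ?_) h2
      simp only [Function.comp]
      rw [hp]
      exact dist_triangle _ _ _
    have hp0C : p0 ∈ C := hC.mem_of_tendsto hq0 (Filter.Eventually.of_forall fun n => hqC _)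
    refine ⟨p0, hp0C, ?_⟩
    have h1 := (hjc.tendsto p0).comp hq0
    have h2 := hy.comp hφ.tendsto_atTop
    refine tendsto_nhds_unique h1 (h2.congr fun n => ?_)
    simp [← hq]

theorem fiberANR_retr {B0 : Type u} [TopologicalSpace B0] [MetrizableSpace B0] {P : Type u}
    [TopologicalSpace P] {πP : P → B0} (hP : IsFiberANR B0 P πP) :
    ∃ (L : Type u) (_ : NormedAddCommGroup L) (_ : NormedSpace ℝ L) (j : P → L)
      (V : Set (B0 × L)) (ρ : V → P), Continuous j ∧ IsOpen V ∧ Continuous ρ ∧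
      (∀ v : V, πP (ρ v) = v.1.1) ∧ (∀ p, (πP p, j p) ∈ V) ∧
      ∀ p (h : (πP p, j p) ∈ V), ρ ⟨_, h⟩ = p := by
  obtain ⟨hm, hπ, hret⟩ := hP
  obtain ⟨L, i1, i2, j, hj⟩ := arens_eells P
  let i : P → B0 × L := fun p => (πP p, j p)
  have hic : Continuous i := hπ.prodMk hj.continuous
  have hi : IsClosedEmbedding i := by
    apply IsClosedEmbedding.of_continuous_injective_isClosedMap hic
    · intro p q h
      exact hj.injective (congrArg Prod.snd h)
    · exact (isProperMap_of_comp_of_t2 (g := Prod.snd) hic continuous_snd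
        hj.isProperMap).isClosedMap
  obtain ⟨U, hU, r, hr, hrm, hrf, hri⟩ := hret (B0 × L) inferInstance inferInstance
    Prod.fst continuous_fst i hi (fun _ => rfl)
  have hV := subset_interior_iff_mem_nhdsSet.2 hU
  let e := hi.isEmbedding.toHomeomorph
  let ρ0 : interior U → Set.range i := fun v => ⟨r ⟨v, interior_subset v.2⟩, hrm _⟩
  have hρ0 : Continuous ρ0 :=
    (hr.comp (continuous_subtype_val.subtype_mk _)).subtype_mk _
  refine ⟨L, i1, i2, j, interior U, fun v => e.symm (ρ0 v), hj.continuous, isOpen_interior,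
    e.symm.continuous.comp hρ0, ?_, fun p => hV ⟨p, rfl⟩, ?_⟩
  · intro v
    have h1 : i (e.symm (ρ0 v)) = ρ0 v := congrArg Subtype.val (e.apply_symm_apply (ρ0 v))
    have h2 : πP (e.symm (ρ0 v)) = (ρ0 v : B0 × L).1 := congrArg Prod.fst h1
    exact h2.trans (hrf _)
  · intro p h
    have h1 : ρ0 ⟨_, h⟩ = e p := Subtype.ext (hri _ ⟨p, rfl⟩)
    simp only [h1, Homeomorph.symm_apply_apply]

theorem fiberANR_open {B0 : Type u} [TopologicalSpace B0] [MetrizableSpace B0] {E : Type u}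
    [NormedAddCommGroup E] [NormedSpace ℝ E] (U : Set (B0 × E)) (hU : IsOpen U) :
    IsFiberANR B0 U (fun u => u.1.1) := by
  refine ⟨inferInstance, by fun_prop, ?_⟩
  intro Z _ hZ πZ hπZ i hi hiπ
  let e := hi.isEmbedding.toHomeomorph
  obtain ⟨g, hg, hgi⟩ := dugundji_ext (Set.range i) hi.isClosed_range
    (fun z => (e.symm z).1.2) (by fun_prop)
  have hgi' : ∀ u, (πZ (i u), g (i u)) = u.1 := by
    intro u
    have h1 : g (i u) = (e.symm (e u)).1.2 := hgi ⟨i u, ⟨u, rfl⟩⟩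
    rw [e.symm_apply_apply] at h1
    rw [h1, hiπ]
  let W : Set Z := {z | (πZ z, g z) ∈ U}
  have hW : IsOpen W := hU.preimage (hπZ.prodMk hg)
  refine ⟨W, hW.mem_nhdsSet.2 ?_, fun w => i ⟨_, w.2⟩, ?_, fun u => ⟨_, rfl⟩, ?_, ?_⟩
  · rintro _ ⟨u, rfl⟩
    change _ ∈ U
    rw [hgi']; exact u.2
  · exact hi.continuous.comp (((hπZ.prodMk hg).comp continuous_subtype_val).subtype_mk _)
  · intro w
    rw [hiπ]
  · rintro ⟨_, hw⟩ ⟨u, rfl⟩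
    simp only
    congr 1
    exact Subtype.ext (hgi' u)

theorem key_E1 {B0 : Type u} [TopologicalSpace B0] [MetrizableSpace B0] {P : Type u}
    [TopologicalSpace P] {πP : P → B0} (hP : IsFiberANR B0 P πP) {X : Type u} [TopologicalSpace X]
    (πX : X → B0) (f : X → P) (hf : Continuous f) (hfπ : ∀ x, πP (f x) = πX x) :
    ∃ (L : Type u) (_ : NormedAddCommGroup L) (_ : NormedSpace ℝ L) (sg : X → L), Continuous sg ∧
      ∀ (W : Type u) [TopologicalSpace W] (πW : W → B0) (_ : Continuous πW) (p : X → W)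
        (_ : ∀ x, πW (p x) = πX x) (T : W → L) (_ : Continuous T) (_ : ∀ x, T (p x) = sg x),
        ∃ O : Set W, IsOpen O ∧ (∀ x, p x ∈ O) ∧ ∃ h : O → P, Continuous h ∧
          (∀ o : O, πP (h o) = πW o) ∧ ∀ x (hx : p x ∈ O), h ⟨_, hx⟩ = f x := by
  obtain ⟨L, i1, i2, j, V, ρ, hj, hV, hρ, hρπ, hjV, hρj⟩ := fiberANR_retr hP
  refine ⟨L, i1, i2, fun x => j (f x), hj.comp hf, ?_⟩
  intro W _ πW hπW p hp T hT hTp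
  have hpx : ∀ x, (πW (p x), T (p x)) = (πP (f x), j (f x)) := fun x => by
    rw [hp, hTp, hfπ]
  refine ⟨{w | (πW w, T w) ∈ V}, hV.preimage (hπW.prodMk hT), ?_,
    fun o => ρ ⟨_, o.2⟩, ?_, ?_, ?_⟩
  · intro x
    change _ ∈ V
    rw [hpx]; exact hjV _
  · exact hρ.comp (((hπW.prodMk hT).comp continuous_subtype_val).subtype_mk _)
  · intro o; rw [hρπ]
  · intro x hx
    exact (congrArg ρ (Subtype.ext (hpx x))).trans (hρj (f x) (hjV _))

theorem key_SE2 {B0 : Type u} [TopologicalSpace B0] [MetrizableSpace B0] {P : Type u}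
    [TopologicalSpace P] {πP : P → B0} (hP : IsFiberANR B0 P πP) {X : Type u} [TopologicalSpace X]
    (πX : X → B0) (Sh : X × unitInterval → P) (hS : Continuous Sh)
    (hSπ : ∀ x t, πP (Sh (x, t)) = πX x) :
    ∃ (L : Type u) (_ : NormedAddCommGroup L) (_ : NormedSpace ℝ L) (sg : X → L), Continuous sg ∧
      ∀ (W : Type u) [TopologicalSpace W] (πW : W → B0) (_ : Continuous πW) (p : X → W)
        (_ : ∀ x, πW (p x) = πX x) (T : W → L) (_ : Continuous T) (_ : ∀ x, T (p x) = sg x)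
        (f0 f1 : W → P) (_ : Continuous f0) (_ : Continuous f1) (_ : ∀ w, πP (f0 w) = πW w)
        (_ : ∀ w, πP (f1 w) = πW w) (_ : ∀ x, Sh (x, 0) = f0 (p x))
        (_ : ∀ x, Sh (x, 1) = f1 (p x)),
        ∃ O : Set W, IsOpen O ∧ (∀ x, p x ∈ O) ∧ ∃ H : O × unitInterval → P, Continuous H ∧
          (∀ (o : O) t, πP (H (o, t)) = πW o) ∧ (∀ o : O, H (o, 0) = f0 o) ∧
          (∀ o : O, H (o, 1) = f1 o) ∧ ∀ x t (hx : p x ∈ O), H (⟨_, hx⟩, t) = Sh (x, t) := by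
  obtain ⟨L, i1, i2, j, V, ρ, hj, hV, hρ, hρπ, hjV, hρj⟩ := fiberANR_retr hP
  let Sc : C(X × unitInterval, L) := ⟨fun z => j (Sh z), hj.comp hS⟩
  refine ⟨C(unitInterval, L), inferInstance, inferInstance, Sc.curry, Sc.curry.continuous, ?_⟩
  intro W _ πW hπW p hp T hT hTp f0 f1 hf0 hf1 hf0π hf1π hS0 hS1
  let G : W × unitInterval → L := fun z => T z.1 z.2 +
    (((1 : ℝ) - z.2) • (j (f0 z.1) - T z.1 0) + (z.2 : ℝ) • (j (f1 z.1) - T z.1 1))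
  have hGc : Continuous G := by
    have h1 : Continuous fun z : W × unitInterval => T z.1 z.2 := by fun_prop
    have h2 : Continuous fun z : W × unitInterval => T z.1 0 := by fun_prop
    have h3 : Continuous fun z : W × unitInterval => T z.1 1 := by fun_prop
    fun_prop
  have hG0 : ∀ w, G (w, 0) = j (f0 w) := fun w => by simp [G]
  have hG1 : ∀ w, G (w, 1) = j (f1 w) := fun w => by simp [G]
  have hGp : ∀ x t, G (p x, t) = j (Sh (x, t)) := fun x t => by
    simp [G, hTp, Sc, hS0, hS1]
  let Q : W × unitInterval → B0 × L := fun z => (πW z.1, G z)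
  have hQ : Continuous Q := (hπW.comp continuous_fst).prodMk hGc
  let O : Set W := {w | ∀ t, Q (w, t) ∈ V}
  have hO : IsOpen O := by
    rw [← isClosed_compl_iff]
    have h1 : IsClosed (Prod.fst '' (Q ⁻¹' V)ᶜ) :=
      isClosedMap_fst_of_compactSpace _ (hV.preimage hQ).isClosed_compl
    convert h1 using 1
    ext w
    simp only [O, mem_compl_iff, mem_ofPred_eq, not_forall, mem_image, mem_preimage]
    constructor
    · rintro ⟨t, ht⟩
      exact ⟨(w, t), ht, rfl⟩
    · rintro ⟨⟨w', t⟩, ht, rfl⟩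
      exact ⟨t, ht⟩
  refine ⟨O, hO, ?_, fun z => ρ ⟨Q (z.1, z.2), z.1.2 z.2⟩, ?_, ?_, ?_, ?_, ?_⟩
  · intro x t
    have : Q (p x, t) = (πP (Sh (x, t)), j (Sh (x, t))) := by
      simp only [Q, hp, hGp, hSπ]
    rw [this]; exact hjV _
  · refine hρ.comp (Continuous.subtype_mk (hQ.comp ?_) _)
    fun_prop
  · intro o t; rw [hρπ]
  · intro o
    exact (congrArg ρ (Subtype.ext (by simp only [Q, hG0, hf0π]))).trans (hρj (f0 o) (hjV _))
  · intro o
    exact (congrArg ρ (Subtype.ext (by simp only [Q, hG1, hf1π]))).trans (hρj (f1 o) (hjV _))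
  · intro x t hx
    exact (congrArg ρ (Subtype.ext (by simp only [Q, hGp, hp, hSπ]))).trans (hρj (Sh (x, t)) (hjV _))
/-- The free vector space on `X` with the topology of a seminorm. -/
def SemF {X : Type u} (_q : Seminorm ℝ (X →₀ ℝ)) : Type u := X →₀ ℝ

noncomputable instance SemF.instAG {X : Type u} (q : Seminorm ℝ (X →₀ ℝ)) :
    AddCommGroup (SemF q) :=
  inferInstanceAs (AddCommGroup (X →₀ ℝ))

noncomputable instance SemF.instMod {X : Type u} (q : Seminorm ℝ (X →₀ ℝ)) :
    Module ℝ (SemF q) :=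
  inferInstanceAs (Module ℝ (X →₀ ℝ))

noncomputable instance SemF.instGrp {X : Type u} (q : Seminorm ℝ (X →₀ ℝ)) :
    SeminormedAddCommGroup (SemF q) :=
  AddGroupSeminorm.toSeminormedAddCommGroup (E := SemF q)
    { toFun := q
      map_zero' := map_zero q
      add_le' := map_add_le_add q
      neg' := map_neg_eq_map q }

noncomputable instance SemF.instSp {X : Type u} (q : Seminorm ℝ (X →₀ ℝ)) :
    NormedSpace ℝ (SemF q) where
  __ := SemF.instMod q
  norm_smul_le a b := (map_smul_eq_mul q a b).le

/-- The normed space associated with a seminorm. -/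
abbrev NF {X : Type u} (q : Seminorm ℝ (X →₀ ℝ)) : Type u := SeparationQuotient (SemF q)

theorem SemF.norm_eq {X : Type u} (q : Seminorm ℝ (X →₀ ℝ)) (v : X →₀ ℝ) :
    ‖(show SemF q from v)‖ = q v := rfl

/-- A linear map bounded by the seminorm is continuous. -/
theorem SemF.cont_of_bound {X : Type u} (q : Seminorm ℝ (X →₀ ℝ)) {L : Type u}
    [SeminormedAddCommGroup L] (T : SemF q → L) (hsub : ∀ a b : SemF q, T a - T b = T (a - b))
    (hT : ∀ v : SemF q, ‖T v‖ ≤ ‖v‖) : Continuous T := by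
  refine (LipschitzWith.of_dist_le_mul (K := 1) fun a b => ?_).continuous
  rw [NNReal.coe_one, one_mul, dist_eq_norm, dist_eq_norm, hsub]
  exact hT _

/-- The class of a vector. -/
noncomputable def NF.mk {X : Type u} (q : Seminorm ℝ (X →₀ ℝ)) (v : X →₀ ℝ) : NF q :=
  SeparationQuotient.mk (X := SemF q) v

theorem NF.mk_surj {X : Type u} (q : Seminorm ℝ (X →₀ ℝ)) (e : NF q) : ∃ v, NF.mk q v = e :=
  SeparationQuotient.surjective_mk e

theorem NF.mk_cont {X : Type u} {q q' : Seminorm ℝ (X →₀ ℝ)} (h : q ≤ q') :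
    Continuous (fun v : SemF q' => NF.mk q v) :=
  SeparationQuotient.continuous_mk.comp
      (SemF.cont_of_bound q' (L := SemF q) (fun v => v) (fun _ _ => rfl) (fun v => h v))

theorem NF.exists_res {X : Type u} {q q' : Seminorm ℝ (X →₀ ℝ)} (h : q ≤ q') :
    ∃ r : NF q' → NF q, Continuous r ∧ ∀ v, r (NF.mk q' v) = NF.mk q v :=
  ⟨SeparationQuotient.lift (fun v : SemF q' => NF.mk q v)
    (fun _ _ hab => (hab.map (NF.mk_cont h)).eq),
    SeparationQuotient.continuous_lift (NF.mk_cont h), fun _ => SeparationQuotient.lift_mk _ _⟩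

/-- Canonical map between the normed spaces. -/
noncomputable def NF.res {X : Type u} {q q' : Seminorm ℝ (X →₀ ℝ)} (h : q ≤ q') :
    NF q' → NF q := Classical.choose (NF.exists_res h)

theorem NF.res_mk {X : Type u} {q q' : Seminorm ℝ (X →₀ ℝ)} (h : q ≤ q') (v : X →₀ ℝ) :
    NF.res h (NF.mk q' v) = NF.mk q v :=
  (Classical.choose_spec (NF.exists_res h)).2 v

theorem NF.res_cont {X : Type u} {q q' : Seminorm ℝ (X →₀ ℝ)} (h : q ≤ q') :
    Continuous (NF.res h) :=
  (Classical.choose_spec (NF.exists_res h)).1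

theorem NF.res_id {X : Type u} {q : Seminorm ℝ (X →₀ ℝ)} (h : q ≤ q) (e : NF q) :
    NF.res h e = e := by
  obtain ⟨v, rfl⟩ := NF.mk_surj q e
  exact NF.res_mk h v

theorem NF.res_comp {X : Type u} {q q' q'' : Seminorm ℝ (X →₀ ℝ)} (h : q ≤ q') (h' : q' ≤ q'')
    (h'' : q ≤ q'') (e : NF q'') : NF.res h (NF.res h' e) = NF.res h'' e := by
  obtain ⟨v, rfl⟩ := NF.mk_surj q'' e
  rw [NF.res_mk, NF.res_mk, NF.res_mk]

/-- The canonical map of `X`. -/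
noncomputable def NF.pt {X : Type u} (q : Seminorm ℝ (X →₀ ℝ)) (x : X) : NF q :=
  NF.mk q (Finsupp.single x 1)

theorem NF.res_pt {X : Type u} {q q' : Seminorm ℝ (X →₀ ℝ)} (h : q ≤ q') (x : X) :
    NF.res h (NF.pt q' x) = NF.pt q x := NF.res_mk h _

/-- Admissible seminorms. -/
def SAdm {X : Type u} [TopologicalSpace X] (q : Seminorm ℝ (X →₀ ℝ)) : Prop :=
  ∀ x, Filter.Tendsto (fun y => q (Finsupp.single y 1 - Finsupp.single x 1)) (𝓝 x) (𝓝 0)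

theorem SAdm.cont {X : Type u} [TopologicalSpace X] {q : Seminorm ℝ (X →₀ ℝ)} (h : SAdm q) :
    Continuous (NF.pt q) := by
  refine SeparationQuotient.continuous_mk.comp
    (f := fun x => (show SemF q from Finsupp.single x 1)) ?_
  rw [continuous_iff_continuousAt]
  intro x
  rw [ContinuousAt, tendsto_iff_norm_sub_tendsto_zero]
  exact h x

theorem SAdm.bot {X : Type u} [TopologicalSpace X] : SAdm (⊥ : Seminorm ℝ (X →₀ ℝ)) := by
  intro x
  simp only [Seminorm.bot_eq_zero, zero_apply]
  exact tendsto_const_nhds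

theorem SAdm.sup {X : Type u} [TopologicalSpace X] {q q' : Seminorm ℝ (X →₀ ℝ)} (h : SAdm q)
    (h' : SAdm q') : SAdm (q ⊔ q') := by
  intro x
  have := (h x).max (h' x)
  simpa [Seminorm.sup_apply] using this

theorem exists_dominating {X : Type u} [TopologicalSpace X] (q : Seminorm ℝ (X →₀ ℝ))
    (hq : SAdm q) {L : Type u} [NormedAddCommGroup L] [NormedSpace ℝ L] (sg : X → L)
    (hs : Continuous sg) :
    ∃ q' : Seminorm ℝ (X →₀ ℝ), q ≤ q' ∧ SAdm q' ∧
      ∃ T : NF q' → L, Continuous T ∧ ∀ x, T (NF.pt q' x) = sg x := by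
  let T0 : (X →₀ ℝ) →ₗ[ℝ] L := Finsupp.linearCombination ℝ sg
  have hT0 : ∀ x, T0 (Finsupp.single x 1) = sg x := fun x => by simp [T0]
  let q1 : Seminorm ℝ (X →₀ ℝ) := (normSeminorm ℝ L).comp T0
  have hq1 : ∀ v, q1 v = ‖T0 v‖ := fun v => rfl
  have hq1a : SAdm q1 := by
    intro x
    simp only [hq1, map_sub, hT0]
    exact tendsto_iff_norm_sub_tendsto_zero.1 (hs.tendsto x)
  have hc : Continuous (fun v : SemF (q ⊔ q1) => T0 v) :=
    SemF.cont_of_bound (q ⊔ q1) T0 (fun a b => (map_sub T0 a b).symm)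
      (fun v => (le_sup_right : q1 ≤ q ⊔ q1) v)
  refine ⟨q ⊔ q1, le_sup_left, hq.sup hq1a,
    SeparationQuotient.lift (fun v : SemF (q ⊔ q1) => T0 v) (fun a b hab => (hab.map hc).eq),
    SeparationQuotient.continuous_lift hc, fun x => ?_⟩
  exact hT0 x

/-- Abstract family of normed spaces under `X`. -/
structure NFam (X : Type u) [TopologicalSpace X] : Type (u + 1) where
  Q : Type u
  le : Q → Q → Prop
  adm : Q → Prop
  exists_sup : ∀ (J : Type u) (f : J → Q), (∀ i, adm (f i)) → ∃ g : Finset J → Q,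
    (∀ s, ∀ a ∈ s, le (f a) (g s)) ∧ (∀ s t, s ⊆ t → le (g s) (g t)) ∧ ∀ s, adm (g s)
  N : Q → Type u
  grp : ∀ q, NormedAddCommGroup (N q)
  sp : ∀ q, NormedSpace ℝ (N q)
  pt : ∀ q, X → N q
  res : ∀ {q q'}, le q q' → N q' → N q
  res_cont : ∀ {q q'} (h : le q q'), Continuous (res h)
  res_id : ∀ {q} (h : le q q) e, res h e = e
  res_comp : ∀ {q q' q''} (h : le q q') (h' : le q' q'') (h'' : le q q'') e,
    res h (res h' e) = res h'' e
  res_pt : ∀ {q q'} (h : le q q') x, res h (pt q' x) = pt q x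
  adm_cont : ∀ q, adm q → Continuous (pt q)
  dom : ∀ q, adm q → ∀ (L : Type u) [NormedAddCommGroup L] [NormedSpace ℝ L] (sg : X → L),
    Continuous sg → ∃ q', le q q' ∧ adm q' ∧
      ∃ T : N q' → L, Continuous T ∧ ∀ x, T (pt q' x) = sg x

attribute [instance] NFam.grp NFam.sp

theorem exists_NFam (X : Type u) [TopologicalSpace X] : Nonempty (NFam X) :=
  ⟨{ Q := Seminorm ℝ (X →₀ ℝ)
     le := fun q q' => q ≤ q'
     adm := SAdm
     exists_sup := by
       classical
       intro J f hf
       refine ⟨fun s => s.sup f, fun s a h => Finset.le_sup h,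
         fun s t h => Finset.sup_mono h, fun s => ?_⟩
       induction s using Finset.induction_on with
       | empty => exact SAdm.bot
       | insert a s _ ih =>
         simp only [Finset.sup_insert]
         exact (hf a).sup ih
     N := fun q => NF q
     grp := fun q => inferInstance
     sp := fun q => inferInstance
     pt := fun q => NF.pt q
     res := fun h => NF.res h
     res_cont := fun h => NF.res_cont h
     res_id := fun h e => NF.res_id h e
     res_comp := fun h h' h'' e => NF.res_comp h h' h'' e
     res_pt := fun h x => NF.res_pt h x
     adm_cont := fun q h => h.cont
     dom := fun q h L _ _ sg hs => exists_dominating q h sg hs }⟩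

/-- Basic indices. -/
structure BIx {B0 : Type u} [TopologicalSpace B0] {X : Type u} [TopologicalSpace X]
    (D : NFam X) (πX : X → B0) : Type u where
  q : D.Q
  adm : D.adm q
  U : Set (B0 × D.N q)
  isOpen : IsOpen U
  mem : ∀ x, (πX x, D.pt q x) ∈ U

section Sys

variable {B0 : Type u} [TopologicalSpace B0] {X : Type u} [TopologicalSpace X] {D : NFam X} {πX : X → B0}

variable (D πX) in
theorem exists_fsq : ∃ Q : Finset (BIx D πX) → D.Q,
    (∀ s, ∀ a ∈ s, D.le a.q (Q s)) ∧ (∀ s t, s ⊆ t → D.le (Q s) (Q t)) ∧ ∀ s, D.adm (Q s) :=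
  D.exists_sup (BIx D πX) (fun a => a.q) (fun a => a.adm)

/-- Seminorm of a finite set of indices. -/
noncomputable def fsq (s : Finset (BIx D πX)) : D.Q :=
  Classical.choose (exists_fsq D πX) s

theorem fsq_le {s : Finset (BIx D πX)} {a : BIx D πX} (h : a ∈ s) : D.le a.q (fsq s) :=
  (Classical.choose_spec (exists_fsq D πX)).1 s a h

theorem fsq_mono {s t : Finset (BIx D πX)} (h : s ⊆ t) : D.le (fsq s) (fsq t) :=
  (Classical.choose_spec (exists_fsq D πX)).2.1 s t h

theorem fsq_adm (s : Finset (BIx D πX)) : D.adm (fsq s) :=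
  (Classical.choose_spec (exists_fsq D πX)).2.2 s

/-- Open set of a finite set of indices. -/
def sU (s : Finset (BIx D πX)) : Set (B0 × D.N (fsq s)) :=
  {z | ∀ a (h : a ∈ s), (z.1, D.res (fsq_le h) z.2) ∈ a.U}

theorem sU_open (s : Finset (BIx D πX)) : IsOpen (sU s) := by
  have : sU s = ⋂ a : s, {z | (z.1, D.res (fsq_le a.2) z.2) ∈ a.1.U} := by
    ext z; simp [sU]
  rw [this]
  refine isOpen_iInter_of_finite fun a => a.1.isOpen.preimage ?_
  exact continuous_fst.prodMk ((D.res_cont _).comp continuous_snd)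

theorem sU_mem (s : Finset (BIx D πX)) (x : X) : (πX x, D.pt (fsq s) x) ∈ sU s := by
  intro a h
  have := a.mem x
  rwa [← D.res_pt (fsq_le h) x] at this

/-- The map to the `s`-th term. -/
noncomputable def smap (s : Finset (BIx D πX)) (x : X) : sU s :=
  ⟨(πX x, D.pt (fsq s) x), sU_mem s x⟩

/-- The bonding maps. -/
noncomputable def sbond {s t : Finset (BIx D πX)} (h : s ⊆ t) (z : sU t) : sU s :=
  ⟨(z.1.1, D.res (fsq_mono h) z.1.2), fun a ha => by
    have := z.2 a (h ha)
    simp only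
    rw [D.res_comp _ _ (fsq_le (h ha))]
    exact this⟩

theorem sbond_cont {s t : Finset (BIx D πX)} (h : s ⊆ t) : Continuous (sbond h) := by
  refine Continuous.subtype_mk ?_ _
  exact (continuous_fst.comp continuous_subtype_val).prodMk
    ((D.res_cont _).comp (continuous_snd.comp continuous_subtype_val))

theorem sbond_id {s : Finset (BIx D πX)} (h : s ⊆ s) (z : sU s) : sbond h z = z :=
  Subtype.ext (Prod.ext rfl (D.res_id (fsq_mono h) z.1.2))

theorem sbond_comp {s t r : Finset (BIx D πX)} (h : s ⊆ t) (h' : t ⊆ r) (h'' : s ⊆ r)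
    (z : sU r) : sbond h (sbond h' z) = sbond h'' z :=
  Subtype.ext (Prod.ext rfl (D.res_comp (fsq_mono h) (fsq_mono h') (fsq_mono h'') z.1.2))

theorem sbond_smap {s t : Finset (BIx D πX)} (h : s ⊆ t) (x : X) :
    sbond h (smap t x) = smap s x :=
  Subtype.ext (Prod.ext rfl (D.res_pt (fsq_mono h) x))

variable (D πX) in
/-- The inverse system. -/
noncomputable abbrev theSys : FibInvSys B0 where
  Idx := Finset (BIx D πX)
  le s t := s ⊆ t
  le_refl _ := Finset.Subset.refl _
  le_trans _ _ _ h h' := Finset.Subset.trans h h'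
  directed a b := by
    classical
    exact ⟨a ∪ b, Finset.subset_union_left, Finset.subset_union_right⟩
  obj s := sU s
  topInst s := inferInstance
  proj s z := z.1.1
  proj_cont s := continuous_fst.comp continuous_subtype_val
  bond s t h := sbond h
  bond_cont s t h := sbond_cont h
  bond_fp _ _ _ _ := rfl
  bond_id s z := sbond_id _ z
  bond_comp _ _ _ h h' z := sbond_comp h h' _ z

/-- The morphism to the system. -/
noncomputable def theMap (D : NFam X) (hπX : Continuous πX) : FibMapToSys X πX (theSys D πX) where
  maps s x := smap (D := D) (πX := πX) s x
  cont s := (hπX.prodMk (D.adm_cont _ (fsq_adm (D := D) (πX := πX) s))).subtype_mk _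
  fp _ _ := rfl
  comm _ _ h x := sbond_smap h x

/-- Refinement step. -/
theorem refine_step (s : Finset (BIx D πX)) {L : Type u} [NormedAddCommGroup L]
    [NormedSpace ℝ L] (sg : X → L) (hs : Continuous sg) :
    ∃ (W : Type u) (_ : TopologicalSpace W) (πW : W → B0) (p : X → W) (T : W → L)
      (k : W → sU s), Continuous πW ∧ (∀ x, πW (p x) = πX x) ∧ Continuous T ∧
      (∀ x, T (p x) = sg x) ∧ Continuous k ∧ (∀ w, (k w).1.1 = πW w) ∧
      (∀ x, k (p x) = smap s x) ∧
      ∀ O : Set W, IsOpen O → (∀ x, p x ∈ O) →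
        ∃ (t : Finset (BIx D πX)) (h : s ⊆ t) (m : sU t → O), Continuous m ∧
          (∀ z, πW (m z) = z.1.1) ∧ (∀ z, k (m z) = sbond h z) ∧
          ∀ x, (m (smap t x) : W) = p x := by
  classical
  obtain ⟨q', hle, hadm, T, hT, hTp⟩ := D.dom (fsq s) (fsq_adm s) L sg hs
  let Ws : Set (B0 × D.N q') := {z | (z.1, D.res hle z.2) ∈ sU s}
  have hr : Continuous fun z : B0 × D.N q' => (z.1, D.res hle z.2) :=
    continuous_fst.prodMk ((D.res_cont _).comp continuous_snd)
  have hWs : IsOpen Ws := (sU_open s).preimage hr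
  have hptW : ∀ x, (πX x, D.pt q' x) ∈ Ws := by
    intro x
    change (πX x, D.res hle (D.pt q' x)) ∈ sU s
    rw [D.res_pt]
    exact sU_mem s x
  refine ⟨Ws, inferInstance, fun w => w.1.1, fun x => ⟨(πX x, D.pt q' x), hptW x⟩,
    fun w => T w.1.2, fun w => ⟨_, w.2⟩, by fun_prop, fun _ => rfl, by fun_prop, hTp,
    (hr.comp continuous_subtype_val).subtype_mk _, fun _ => rfl,
    fun x => Subtype.ext (Prod.ext rfl (D.res_pt hle x)), ?_⟩
  intro O hO hpO
  let a : BIx D πX := ⟨q', hadm, Subtype.val '' O, hWs.isOpenMap_subtype_val O hO,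
    fun x => ⟨_, hpO x, rfl⟩⟩
  have ha : a ∈ insert a s := Finset.mem_insert_self _ _
  have hm : ∀ z : sU (insert a s), ∃ h : (z.1.1, D.res (fsq_le ha) z.1.2) ∈ Ws,
      (⟨_, h⟩ : Ws) ∈ O := by
    intro z
    obtain ⟨w, hw, hwe⟩ := z.2 a ha
    have : (z.1.1, D.res (fsq_le ha) z.1.2) ∈ Ws := hwe ▸ w.2
    refine ⟨this, ?_⟩
    have h2 : (⟨_, this⟩ : Ws) = w := Subtype.ext hwe.symm
    rw [h2]
    exact hw
  refine ⟨insert a s, Finset.subset_insert _ _, fun z => ⟨⟨_, (hm z).1⟩, (hm z).2⟩, ?_,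
    fun _ => rfl, ?_, fun x => Subtype.ext (Prod.ext rfl (D.res_pt (fsq_le ha) x))⟩
  · refine Continuous.subtype_mk (Continuous.subtype_mk ?_ _) _
    exact (continuous_fst.comp continuous_subtype_val).prodMk
      ((D.res_cont _).comp (continuous_snd.comp continuous_subtype_val))
  · intro z
    exact Subtype.ext (Prod.ext rfl (D.res_comp hle (fsq_le ha)
      (fsq_mono (Finset.subset_insert a s)) z.1.2))

end Sys

/-- Corollary 1.7: every space `X` over `B0` admits a cofinite strong `ANR_{B0}`-expansion. -/
theorem exists_cofinite_strong_fiberANR_expansion (B0 : Type u) [TopologicalSpace B0]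
    [MetrizableSpace B0] (X : Type u) [TopologicalSpace X] (πX : X → B0) (hπX : Continuous πX) :
    ∃ (S : FibInvSys B0) (p : FibMapToSys X πX S),
      (∀ a : S.Idx, {b : S.Idx | S.le b a}.Finite) ∧
      (∀ a : S.Idx, IsFiberANR B0 (S.obj a) (S.proj a)) ∧
      IsFibStrongExpansion X πX S p := by
  obtain ⟨D⟩ := exists_NFam X
  refine ⟨theSys D πX, theMap D hπX, ?_, ?_, ?_, ?_⟩
  · intro s
    exact (Finset.finite_toSet (Finset.powerset s)).subset fun t ht => by
      simpa using (show t ⊆ s from ht)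
  · intro s
    exact fiberANR_open (sU s) (sU_open s)
  · intro P _ πP hP f hf
    obtain ⟨L, _, _, sg, hsg, hkey⟩ := key_E1 hP πX f hf.1 hf.2
    obtain ⟨W, _, πW, p, T, k, hπW, hp, hT, hTp, -, -, -, hstep⟩ :=
      refine_step (D := D) (πX := πX) ∅ sg hsg
    obtain ⟨O, hO, hpO, h, hh, hhπ, hhp⟩ := hkey W πW hπW p hp T hT hTp
    obtain ⟨t, -, m, hm, hmπ, -, hmp⟩ := hstep O hO hpO
    refine ⟨t, fun z => h (m z), ⟨hh.comp hm, fun z => (hhπ _).trans (hmπ z)⟩, ?_⟩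
    have hfin : ∀ x, h (m ((theMap D hπX).maps t x)) = f x := by
      intro x
      rw [← hhp x (hpO x)]
      congr 1
      exact Subtype.ext (hmp x)
    refine ⟨fun z => f z.1, hf.1.comp continuous_fst, fun x => (hfin x).symm, fun x => rfl,
      fun x _ => hf.2 x⟩
  · intro P _ πP hP s f0 f1 hf0 hf1 Sh hS hSπ hS0 hS1
    obtain ⟨L, _, _, sg, hsg, hkey⟩ := key_SE2 hP πX Sh hS hSπ
    obtain ⟨W, _, πW, p, T, k, hπW, hp, hT, hTp, hk, hkπ, hkp, hstep⟩ :=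
      refine_step (D := D) (πX := πX) s sg hsg
    obtain ⟨O, hO, hpO, H, hH, hHπ, hH0, hH1, hHp⟩ := hkey W πW hπW p hp T hT hTp
      (fun w => f0 (k w)) (fun w => f1 (k w)) (hf0.1.comp hk) (hf1.1.comp hk)
      (fun w => (hf0.2 _).trans (hkπ w)) (fun w => (hf1.2 _).trans (hkπ w))
      (fun x => by rw [hkp]; exact hS0 x) (fun x => by rw [hkp]; exact hS1 x)
    obtain ⟨t, hst, m, hm, hmπ, hmk, hmp⟩ := hstep O hO hpO
    refine ⟨t, hst, fun z => H (m z.1, z.2), ?_, ?_, ?_, ?_, ?_⟩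
    · exact hH.comp ((hm.comp continuous_fst).prodMk continuous_snd)
    · exact fun z τ => (hHπ _ _).trans (hmπ z)
    · exact fun z => (hH0 _).trans (congrArg f0 (hmk z))
    · exact fun z => (hH1 _).trans (congrArg f1 (hmk z))
    · have hfin : ∀ x τ, H (m ((theMap D hπX).maps t x), τ) = Sh (x, τ) := by
        intro x τ
        rw [← hHp x τ (hpO x)]
        congr 2
        exact Subtype.ext (hmp x)
      exact ⟨fun z => Sh z.1, hS.comp continuous_fst, fun _ => rfl,
        fun z => (hfin z.1 z.2).symm, fun z _ => hSπ z.1 z.2, fun _ _ => rfl, fun _ _ => rfl⟩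
end

section
/- Let p : X → X = (X_α, p_{αα'}, 𝒜) be a resolution over B0, let P be an ANR_{B0}-space, let f0, f1 : X_α → P be f.p. maps for some α ∈ 𝒜, and let S : X × I → P be an f.p. homotopy with S(x,0) = f0(p_α(x)) and S(x,1) = f1(p_α(x)). Then for every open cover 𝒰 of P there exist α' ≥ α and an f.p. homotopy H : X_{α'} × I → P with H(y,0) = f0(p_{αα'}(y)), H(y,1) = f1(p_{αα'}(y)) for all y ∈ X_{α'}, and such that S and H ∘ (p_{α'} × id_I) are 𝒰-near. -/
open Set Topology TopologicalSpace unitInterval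

universe u

/-- Dugundji extension theorem (into a normed space). -/
theorem dug_ext {X L : Type u} [TopologicalSpace X] [MetrizableSpace X]
    [NormedAddCommGroup L] [NormedSpace ℝ L] {A : Set X} (hA : IsClosed A) (hne : A.Nonempty)
    (f : X → L) (hf : ContinuousOn f A) : ∃ F : X → L, Continuous F ∧ ∀ a ∈ A, F a = f a := by
  classical
  letI := metrizableSpaceMetric X
  have key : ∃ g : C((Aᶜ : Set X), L), ∀ x : (Aᶜ : Set X), g x ∈ convexHull ℝ
      (f '' {a | a ∈ A ∧ dist (x : X) a < 2 * Metric.infDist (x : X) A}) := by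
    apply exists_continuous_forall_mem_convex_of_local_const
    · intro x; exact convex_convexHull ℝ _
    · intro x
      have hpos : 0 < Metric.infDist (x : X) A :=
        (hA.notMem_iff_infDist_pos hne).1 x.2
      obtain ⟨a, haA, ha⟩ := (Metric.infDist_lt_iff hne).1
        (show Metric.infDist (x : X) A < 2 * Metric.infDist (x : X) A by linarith)
      refine ⟨f a, ?_⟩
      have h1 : Continuous fun y : (Aᶜ : Set X) => dist (y : X) a := by fun_prop
      have h2 : Continuous fun y : (Aᶜ : Set X) => 2 * Metric.infDist (y : X) A :=
        continuous_const.mul ((Metric.continuous_infDist_pt A).comp continuous_subtype_val)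
      filter_upwards [h1.continuousAt.eventually_lt h2.continuousAt ha] with y hy
      exact subset_convexHull ℝ _ ⟨a, ⟨haA, hy⟩, rfl⟩
  obtain ⟨g, hg⟩ := key
  let F : X → L := fun x => if h : x ∈ A then f x else g ⟨x, h⟩
  have hFA : ∀ a ∈ A, F a = f a := fun a ha => by simp [F, ha]
  refine ⟨F, ?_, hFA⟩
  rw [continuous_iff_continuousAt]
  intro x0
  by_cases hx0 : x0 ∈ A
  · rw [Metric.continuousAt_iff]
    intro ε hε
    obtain ⟨δ, hδ, hd⟩ := Metric.continuousOn_iff.1 hf x0 hx0 ε hε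
    refine ⟨δ / 3, by positivity, fun {x} hx => ?_⟩
    rw [hFA x0 hx0]
    by_cases hxA : x ∈ A
    · rw [hFA x hxA]; exact hd x hxA (by linarith)
    · have : F x = g ⟨x, hxA⟩ := by simp [F, hxA]
      rw [this]
      have hsub : convexHull ℝ
        (f '' {a | a ∈ A ∧ dist x a < 2 * Metric.infDist x A}) ⊆ Metric.ball (f x0) ε := by
        apply convexHull_min _ (convex_ball _ _)
        rintro _ ⟨a, ⟨haA, ha⟩, rfl⟩
        apply hd a haA
        have h3 := Metric.infDist_le_dist_of_mem (x := x) hx0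
        have h4 := dist_triangle a x x0
        rw [dist_comm a x] at h4
        linarith
      exact hsub (hg ⟨x, hxA⟩)
  · have hop : IsOpen (Aᶜ) := hA.isOpen_compl
    have : ContinuousOn F Aᶜ := by
      rw [continuousOn_iff_continuous_domRestrict]
      convert g.continuous using 1
      ext1 x
      have : (x : X) ∉ A := x.2
      simp [F, this]
    exact this.continuousAt (hop.mem_nhds hx0)

/-- Kuratowski embedding into bounded continuous functions. -/
theorem kur_emb (P : Type u) [MetricSpace P] [Nonempty P] :
    ∃ e : P → BoundedContinuousFunction P ℝ, Isometry e := by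
  obtain ⟨p0⟩ := ‹Nonempty P›
  let e : P → BoundedContinuousFunction P ℝ := fun p =>
    BoundedContinuousFunction.ofNormedAddCommGroup (fun q => dist p q - dist p0 q)
      (by fun_prop) (dist p p0) (fun q => by
        rw [Real.norm_eq_abs]; exact abs_dist_sub_le p p0 q)
  refine ⟨e, Isometry.of_dist_eq fun p q => le_antisymm ?_ ?_⟩
  · rw [BoundedContinuousFunction.dist_le dist_nonneg]
    intro x
    have : dist (e p x) (e q x) = |dist p x - dist q x| := by
      rw [Real.dist_eq]; congr 1; simp [e]
    rw [this]; exact abs_dist_sub_le p q x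
  · have h := BoundedContinuousFunction.dist_coe_le_dist (f := e p) (g := e q) q
    have : dist (e p q) (e q q) = |dist p q| := by
      rw [Real.dist_eq]; congr 1; simp [e]
    rw [this] at h
    exact (le_abs_self _).trans h

/-- Neighbourhood extension property, with total functions. -/
def ANEt (B0 : Type u) [TopologicalSpace B0] (Y : Type u) [TopologicalSpace Y]
    (πY : Y → B0) : Prop :=
  ∀ (X : Type u) (_ : TopologicalSpace X), MetrizableSpace X →
    ∀ πX : X → B0, Continuous πX → ∀ A : Set X, IsClosed A →
    ∀ f : X → Y, ContinuousOn f A → (∀ a ∈ A, πY (f a) = πX a) →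
    ∃ U : Set X, IsOpen U ∧ A ⊆ U ∧ ∃ g : X → Y, ContinuousOn g U ∧
      (∀ u ∈ U, πY (g u) = πX u) ∧ ∀ a ∈ A, g a = f a

theorem anr_to_ane (B0 : Type u) [TopologicalSpace B0] [MetrizableSpace B0]
    (P : Type u) [TopologicalSpace P] (πP : P → B0) (hP : IsFiberANR B0 P πP) :
    ANEt B0 P πP := by
  classical
  intro X _ hX πX hπX A hA f hf hfp
  rcases A.eq_empty_or_nonempty with rfl | hne
  · exact ⟨∅, isOpen_empty, subset_rfl, f, by simp, by simp, by simp⟩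
  obtain ⟨hPm, hπP, hret⟩ := hP
  letI := metrizableSpaceMetric P
  letI := metrizableSpaceMetric X
  haveI : Nonempty P := ⟨f hne.some⟩
  obtain ⟨e, he⟩ := kur_emb P
  obtain ⟨F, hF, hFA⟩ := dug_ext hA hne (fun x => e (f x)) (he.continuous.comp_continuousOn hf)
  let Z : Type u := {z : B0 × BoundedContinuousFunction P ℝ × ℝ //
    z.2.2 = 0 → ∃ q : P, πP q = z.1 ∧ e q = z.2.1}
  have hZm : MetrizableSpace Z :=
    IsEmbedding.metrizableSpace (f := (Subtype.val : Z → _)) ⟨⟨rfl⟩, Subtype.val_injective⟩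
  let i : P → Z := fun q => ⟨(πP q, e q, 0), fun _ => ⟨q, rfl, rfl⟩⟩
  have hic : Continuous i :=
    (hπP.prodMk (he.continuous.prodMk continuous_const)).subtype_mk _
  have hrange : range i = {z : Z | z.1.2.2 = 0} := by
    ext z
    constructor
    · rintro ⟨q, rfl⟩; rfl
    · intro hz
      obtain ⟨q, h1, h2⟩ := z.2 hz
      exact ⟨q, Subtype.ext (Prod.ext h1 (Prod.ext h2 (Eq.symm hz)))⟩
  have hcl : IsClosedEmbedding i := by
    refine ⟨?_, ?_⟩
    · exact IsEmbedding.of_comp hic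
        (continuous_fst.comp (continuous_snd.comp continuous_subtype_val) :
          Continuous fun z : Z => z.1.2.1) he.isEmbedding
    · rw [hrange]
      exact isClosed_eq (continuous_snd.comp (continuous_snd.comp continuous_subtype_val))
        continuous_const
  obtain ⟨U, hU, r, hr, hrr, hrfp, hrid⟩ := hret Z inferInstance hZm
    (fun z => z.1.1) (continuous_fst.comp continuous_subtype_val) i hcl (fun _ => rfl)
  let Φ : X → Z := fun x => ⟨(πX x, F x, Metric.infDist x A), fun h => by
    have hx : x ∈ A := (hA.mem_iff_infDist_zero hne).2 h
    exact ⟨f x, hfp x hx, (hFA x hx).symm⟩⟩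
  have hΦ : Continuous Φ :=
    (hπX.prodMk (hF.prodMk (Metric.continuous_infDist_pt A))).subtype_mk _
  have hΦA : ∀ a ∈ A, Φ a = i (f a) := fun a ha =>
    Subtype.ext (Prod.ext (hfp a ha).symm (Prod.ext (hFA a ha)
      (Metric.infDist_zero_of_mem ha)))
  choose s hs using hrr
  let g : X → P := fun x => if h : Φ x ∈ U then s ⟨Φ x, h⟩ else f x
  have hUi : range i ⊆ interior U := subset_interior_iff_mem_nhdsSet.2 hU
  have hg : ∀ x (h : Φ x ∈ U), i (g x) = r ⟨Φ x, h⟩ := fun x h => by simp [g, h, hs]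
  refine ⟨Φ ⁻¹' interior U, isOpen_interior.preimage hΦ, ?_, g, ?_, ?_, ?_⟩
  · intro a ha
    exact hUi ⟨f a, (hΦA a ha).symm⟩
  · rw [hcl.isInducing.continuousOn_iff, continuousOn_iff_continuous_domRestrict]
    have : Continuous fun x : (Φ ⁻¹' interior U) => r ⟨Φ x, interior_subset x.2⟩ :=
      hr.comp ((hΦ.comp continuous_subtype_val).subtype_mk _)
    convert this using 1
    ext1 x
    exact hg x (interior_subset x.2)
  · intro u hu
    have h1 := hrfp ⟨Φ u, interior_subset hu⟩
    rw [← hg] at h1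
    exact h1
  · intro a ha
    have hm : Φ a ∈ range i := ⟨f a, (hΦA a ha).symm⟩
    have hU' : Φ a ∈ U := interior_subset (hUi hm)
    have h1 := hrid ⟨Φ a, hU'⟩ hm
    rw [← hg] at h1
    apply hcl.injective
    rw [h1]; exact hΦA a ha

theorem ane_to_anr (B0 : Type u) [TopologicalSpace B0]
    (P : Type u) [TopologicalSpace P] (πP : P → B0) [Nonempty P] (hm : MetrizableSpace P)
    (hπP : Continuous πP) (hP : ANEt B0 P πP) : IsFiberANR B0 P πP := by
  refine ⟨hm, hπP, fun X _ hX πX hπX i hi hip => ?_⟩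
  have hli := Function.leftInverse_invFun hi.injective
  obtain ⟨U, hU, hAU, g, hg, hgp, hgA⟩ := hP X _ hX πX hπX (range i) hi.isClosed_range
    (Function.invFun i)
    (by
      rw [hi.isInducing.continuousOn_iff]
      refine continuousOn_id.congr ?_
      rintro _ ⟨q, rfl⟩
      simp [hli q])
    (by rintro _ ⟨q, rfl⟩; rw [hli q, hip])
  refine ⟨U, hU.mem_nhdsSet.2 hAU, fun u => i (g u),
    hi.continuous.comp (continuousOn_iff_continuous_domRestrict.1 hg), fun u => ⟨_, rfl⟩,
    fun u => by rw [hip]; exact hgp u u.2, ?_⟩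
  rintro ⟨_, hu⟩ ⟨q, rfl⟩
  simp only
  rw [hgA _ ⟨q, rfl⟩, hli q]

theorem tube_open {X : Type u} [TopologicalSpace X] {U : Set (X × unitInterval)}
    (hU : IsOpen U) : IsOpen {x | ∀ t, (x, t) ∈ U} := by
  rw [isOpen_iff_mem_nhds]
  intro x hx
  have := isCompact_univ.eventually_forall_of_forall_eventually (x₀ := x) (K := (univ : Set unitInterval))
    (P := fun x t => (x, t) ∈ U) (fun t _ => hU.mem_nhds (hx t))
  filter_upwards [this] with y hy t using hy t trivial

/-- Paths in fibres together with two extra points of the fibre. -/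
abbrev FE {B0 P : Type u} [TopologicalSpace P] (πP : P → B0) : Type u :=
  {e : C(unitInterval, P) × P × P // (∀ t, πP (e.1 t) = πP e.2.1) ∧ πP e.2.2 = πP e.2.1}

theorem FE_metr {B0 P : Type u} [TopologicalSpace P] [MetrizableSpace P] (πP : P → B0) :
    MetrizableSpace (FE πP) :=
  IsEmbedding.metrizableSpace (f := (Subtype.val : FE πP → _)) ⟨⟨rfl⟩, Subtype.val_injective⟩

theorem FE_ane (B0 : Type u) [TopologicalSpace B0] 
    (P : Type u) [TopologicalSpace P] [Nonempty P] (πP : P → B0) (hP : ANEt B0 P πP) :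
    ANEt B0 (FE πP) (fun e => πP e.1.2.1) := by
  classical
  intro X _ hX πX hπX A hA f hf hfp
  have hfv : ContinuousOn (fun x => (f x).1) A := continuous_subtype_val.comp_continuousOn hf
  obtain ⟨U, hU, hAU, g, hg, hgp, hgA⟩ := hP (X × unitInterval) _ inferInstance
    (fun z => πX z.1) (hπX.comp continuous_fst) (A ×ˢ univ) (hA.prod isClosed_univ)
    (fun z => (f z.1).1.1 z.2)
    (by
      have h1 : ContinuousOn (fun z : X × unitInterval => (f z.1).1.1) (A ×ˢ univ) :=
        (continuous_fst.comp_continuousOn hfv).comp continuousOn_fst (fun z hz => hz.1)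
      exact h1.eval continuousOn_snd)
    (by rintro ⟨x, t⟩ ⟨hx, -⟩; exact ((f x).2.1 t).trans (hfp x hx))
  obtain ⟨U0, hU0, hAU0, g0, hg0, hgp0, hgA0⟩ := hP X _ hX πX hπX A hA
    (fun x => (f x).1.2.1) (continuous_fst.comp_continuousOn (continuous_snd.comp_continuousOn hfv))
    hfp
  obtain ⟨U1, hU1, hAU1, g1, hg1, hgp1, hgA1⟩ := hP X _ hX πX hπX A hA
    (fun x => (f x).1.2.2) (continuous_snd.comp_continuousOn (continuous_snd.comp_continuousOn hfv))
    (fun a ha => (f a).2.2.trans (hfp a ha))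
  let W : Set X := {x | ∀ t, (x, t) ∈ U} ∩ U0 ∩ U1
  have hc : ∀ x ∈ W, Continuous fun t => g (x, t) := fun x hx =>
    hg.comp_continuous (by fun_prop) (fun t => hx.1.1 t)
  let k : X → C(unitInterval, P) := fun x => ContinuousMap.mkD (fun t => g (x, t))
    (ContinuousMap.const _ (Classical.arbitrary P))
  have hk : ∀ x ∈ W, ∀ t, k x t = g (x, t) := fun x hx t => by
    simp only [k]; rw [ContinuousMap.mkD_apply_of_continuous (hc x hx)]
  have hkc : ContinuousOn k W := by
    apply ContinuousMap.continuousOn_of_continuousOn_uncurry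
    refine (hg.mono (t := W ×ˢ univ) ?_).congr ?_
    · rintro ⟨x, t⟩ ⟨hx, -⟩; exact hx.1.1 t
    · rintro ⟨x, t⟩ ⟨hx, -⟩; exact hk x hx t
  have hprop : ∀ x ∈ W, (∀ t, πP (k x t) = πP (g0 x)) ∧ πP (g1 x) = πP (g0 x) := fun x hx =>
    ⟨fun t => by rw [hk x hx, hgp0 x hx.1.2]; exact hgp _ (hx.1.1 t),
      by rw [hgp0 x hx.1.2, hgp1 x hx.2]⟩
  let G : X → FE πP := fun x => if h : x ∈ W then ⟨(k x, g0 x, g1 x), hprop x h⟩ else f x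
  have hG : ∀ x ∈ W, (G x).1 = (k x, g0 x, g1 x) := fun x hx => by simp [G, hx]
  have hAW : A ⊆ W := fun x hx => ⟨⟨fun t => hAU ⟨hx, trivial⟩, hAU0 hx⟩, hAU1 hx⟩
  refine ⟨W, ((tube_open hU).inter hU0).inter hU1, hAW, G, ?_, ?_, ?_⟩
  · rw [(⟨rfl⟩ : IsInducing (Subtype.val : FE πP → _)).continuousOn_iff]
    refine ContinuousOn.congr (f := fun x => (k x, g0 x, g1 x)) ?_ (fun x hx => hG x hx)
    exact hkc.prodMk ((hg0.mono fun x hx => hx.1.2).prodMk (hg1.mono fun x hx => hx.2))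
  · intro x hx
    simp only [hG x hx]
    exact hgp0 x hx.1.2
  · intro x hx
    apply Subtype.ext
    rw [hG x (hAW hx), hgA0 x hx, hgA1 x hx]
    refine Prod.ext ?_ rfl
    ext t
    exact (hk x (hAW hx) t).trans (hgA (x, t) ⟨hx, trivial⟩)

/-- Correction of endpoints. -/
theorem FE_corr (B0 : Type u) [TopologicalSpace B0]
    (P : Type u) [TopologicalSpace P] [MetrizableSpace P] (πP : P → B0) (hπP : Continuous πP)
    (hP : ANEt B0 P πP) (D : Set (FE πP)) (hD : D = {e | e.1.1 0 = e.1.2.1 ∧ e.1.1 1 = e.1.2.2}) :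
    IsClosed D ∧ ∃ (W : Set (FE πP)) (R : FE πP × unitInterval → P), IsOpen W ∧ D ⊆ W ∧
      ContinuousOn R (W ×ˢ univ) ∧ (∀ e ∈ W, ∀ t, πP (R (e, t)) = πP e.1.2.1) ∧
      (∀ e ∈ W, R (e, 0) = e.1.2.1) ∧ (∀ e ∈ W, R (e, 1) = e.1.2.2) ∧
      ∀ e ∈ D, ∀ t, R (e, t) = e.1.1 t := by
  classical
  have hmet := FE_metr πP
  have hDc : IsClosed D := by
    rw [hD]
    exact (isClosed_eq (by fun_prop) (by fun_prop)).inter (isClosed_eq (by fun_prop) (by fun_prop))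
  refine ⟨hDc, ?_⟩
  let C0 : Set (FE πP × unitInterval) := {z | z.2 = 0}
  let C1 : Set (FE πP × unitInterval) := {z | z.2 = 1}
  let C2 : Set (FE πP × unitInterval) := {z | z.1 ∈ D}
  have h0 : IsClosed C0 := isClosed_eq continuous_snd continuous_const
  have h1 : IsClosed C1 := isClosed_eq continuous_snd continuous_const
  have h2 : IsClosed C2 := hDc.preimage continuous_fst
  let k : FE πP × unitInterval → P := fun z =>
    if z.2 = 0 then z.1.1.2.1 else if z.2 = 1 then z.1.1.2.2 else z.1.1.1 z.2
  have hk0 : ∀ z ∈ C0, k z = z.1.1.2.1 := fun z hz => if_pos hz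
  have hk1 : ∀ z ∈ C1, k z = z.1.1.2.2 := fun z hz => by
    have hz : z.2 = 1 := hz
    simp [k, hz]
  have hk2 : ∀ z ∈ C2, k z = z.1.1.1 z.2 := by
    rintro ⟨e, t⟩ hz
    have hz : e ∈ D := hz
    rw [hD] at hz
    obtain ⟨hz0, hz1⟩ := hz
    by_cases ht : t = 0
    · subst ht; rw [hk0 _ rfl]; exact hz0.symm
    by_cases ht1 : t = 1
    · subst ht1; rw [hk1 _ rfl]; exact hz1.symm
    simp [k, ht, ht1]
  have hkc : ContinuousOn k ((C0 ∪ C1) ∪ C2) := by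
    refine ContinuousOn.union_of_isClosed (ContinuousOn.union_of_isClosed ?_ ?_ h0 h1) ?_
      (h0.union h1) h2
    · exact ContinuousOn.congr (by fun_prop) hk0
    · exact ContinuousOn.congr (by fun_prop) hk1
    · exact ContinuousOn.congr (by fun_prop) hk2
  obtain ⟨U, hU, hAU, g, hg, hgp, hgA⟩ := hP (FE πP × unitInterval) _ inferInstance
    (fun z => πP z.1.1.2.1) (by fun_prop) _ ((h0.union h1).union h2) k hkc (by
      rintro z ((hz | hz) | hz)
      · rw [hk0 z hz]
      · rw [hk1 z hz]; exact z.1.2.2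
      · rw [hk2 z hz]; exact z.1.2.1 _)
  refine ⟨{e | ∀ t, (e, t) ∈ U}, g, tube_open hU, fun e he t => hAU (Or.inr he),
    hg.mono ?_, fun e he t => hgp _ (he t), fun e he => ?_, fun e he => ?_, fun e he t => ?_⟩
  · rintro ⟨e, t⟩ ⟨he, -⟩; exact he t
  · rw [hgA _ (Or.inl (Or.inl rfl)), hk0 _ rfl]
  · rw [hgA _ (Or.inl (Or.inr rfl)), hk1 _ rfl]
  · rw [hgA _ (Or.inr he), hk2 _ he]

/-- Mixed element: path of `e`, points of `e'`. -/
def FEmix {B0 P : Type u} [TopologicalSpace P] (πP : P → B0) (e e' : FE πP)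
    (h : πP e.1.2.1 = πP e'.1.2.1) : FE πP :=
  ⟨(e.1.1, e'.1.2.1, e'.1.2.2), fun t => (e.2.1 t).trans h, e'.2.2⟩

/-- Replace the two points by the end points of the path. -/
def FEend {B0 P : Type u} [TopologicalSpace P] (πP : P → B0) (e : FE πP) : FE πP :=
  ⟨(e.1.1, e.1.1 0, e.1.1 1), fun t => (e.2.1 t).trans (e.2.1 0).symm,
    (e.2.1 1).trans (e.2.1 0).symm⟩

theorem FE_cover (B0 : Type u) [TopologicalSpace B0]
    (P : Type u) [TopologicalSpace P] (πP : P → B0)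
    (D : Set (FE πP)) (hD : D = {e | e.1.1 0 = e.1.2.1 ∧ e.1.1 1 = e.1.2.2})
    (hDc : IsClosed D) (W : Set (FE πP)) (R : FE πP × unitInterval → P) (hW : IsOpen W)
    (hDW : D ⊆ W) (hR : ContinuousOn R (W ×ˢ univ)) (hRD : ∀ e ∈ D, ∀ t, R (e, t) = e.1.1 t)
    (𝒰 : Set (Set P)) (h𝒰 : IsOpenCover 𝒰) (𝒱 : Set (Set (FE πP))) (h𝒱 : IsOpenCover 𝒱)
    (e0 : FE πP) :
    ∃ V : Set (FE πP), IsOpen V ∧ e0 ∈ V ∧ ∀ e ∈ V, ∀ e' ∈ V, e' ∈ D →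
      ∀ h : πP e.1.2.1 = πP e'.1.2.1,
      (∃ U ∈ 𝒱, FEend πP e ∈ U ∧ FEmix πP e e' h ∈ U) ∧
      ∀ t, ∃ U ∈ 𝒰, e'.1.1 t ∈ U ∧ R (FEmix πP e e' h, t) ∈ U := by
  by_cases he0 : e0 ∈ D
  swap
  · exact ⟨Dᶜ, hDc.isOpen_compl, he0, fun e _ e' he' h' => absurd h' he'⟩
  have hends : FEend πP e0 = e0 := by
    have h := he0
    rw [hD] at h
    exact Subtype.ext (Prod.ext rfl (Prod.ext h.1 h.2))
  have hendc : Continuous (FEend πP) :=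
    Continuous.subtype_mk (by fun_prop) _
  let T : Type u := {τ : FE πP × FE πP // πP τ.1.1.2.1 = πP τ.2.1.2.1}
  let m : T → FE πP := fun τ => FEmix πP τ.1.1 τ.1.2 τ.2
  have hm : Continuous m := Continuous.subtype_mk (by fun_prop) _
  let τ0 : T := ⟨(e0, e0), rfl⟩
  have hm0 : m τ0 = e0 := rfl
  obtain ⟨U', hU', he0U'⟩ : ∃ U ∈ 𝒱, e0 ∈ U := by
    have : e0 ∈ ⋃₀ 𝒱 := by rw [h𝒱.2]; trivial
    exact this
  let N : Set (T × unitInterval) := ⋃ U ∈ 𝒰,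
    ((fun z : T × unitInterval => (m z.1, z.2)) ⁻¹' ((W ×ˢ univ) ∩ R ⁻¹' U)) ∩
      ((fun z : T × unitInterval => z.1.1.2.1.1 z.2) ⁻¹' U)
  have hN : IsOpen N := by
    refine isOpen_biUnion fun U hU => IsOpen.inter ?_ ?_
    · exact (hR.isOpen_inter_preimage (hW.prod isOpen_univ) (h𝒰.1 U hU)).preimage (by fun_prop)
    · exact (h𝒰.1 U hU).preimage ((continuous_fst.comp (continuous_subtype_val.comp
        (continuous_snd.comp (continuous_subtype_val.comp continuous_fst)))).eval continuous_snd)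
  have hO : ∀ᶠ τ in 𝓝 τ0, (FEend πP τ.1.1 ∈ U' ∧ m τ ∈ U') ∧ ∀ t, (τ, t) ∈ N := by
    refine Filter.Eventually.and (Filter.Eventually.and ?_ ?_) ?_
    · have hc : Continuous fun τ : T => FEend πP τ.1.1 := hendc.comp (by fun_prop)
      exact hc.continuousAt.eventually_mem ((h𝒱.1 U' hU').mem_nhds (by
        change FEend πP e0 ∈ U'; rwa [hends]))
    · exact hm.continuousAt.eventually_mem ((h𝒱.1 U' hU').mem_nhds he0U')
    · refine (tube_open hN).mem_nhds fun t => ?_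
      obtain ⟨U, hU, hU2⟩ : ∃ U ∈ 𝒰, e0.1.1 t ∈ U := by
        have : e0.1.1 t ∈ ⋃₀ 𝒰 := by rw [h𝒰.2]; trivial
        exact this
      refine mem_iUnion₂.2 ⟨U, hU, ⟨⟨hDW he0, trivial⟩, ?_⟩, hU2⟩
      change R (e0, t) ∈ U
      rwa [hRD e0 he0]
  have hind : IsInducing (Subtype.val : T → _) := ⟨rfl⟩
  rw [hind.nhds_eq_comap, Filter.eventually_comap, nhds_prod_eq] at hO
  obtain ⟨V1, hV1, V2, hV2, hV⟩ := Filter.eventually_prod_iff.1 hO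
  obtain ⟨V, hVs, hVo, hVe⟩ := mem_nhds_iff.1 (Filter.inter_mem hV1 hV2)
  refine ⟨V, hVo, hVe, fun e he e' he' _ h => ?_⟩
  obtain ⟨h1, h2⟩ := hV (hVs he).1 (hVs he').2 ⟨(e, e'), h⟩ rfl
  refine ⟨⟨U', hU', h1⟩, fun t => ?_⟩
  obtain ⟨U, hU, h3, h4⟩ := mem_iUnion₂.1 (h2 t)
  exact ⟨U, hU, h4, h3.2⟩

/-- Lemma 1.9: if `p : X → (X_α)` is a resolution over `B0`, `f0, f1 : X_α → P` are f.p. maps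
into an `ANR_{B0}`-space `P` and `Sh : X × I → P` is an f.p. homotopy from `f0 ∘ p_α` to
`f1 ∘ p_α`, then for every open cover `𝒰` of `P` there are `α' ≥ α` and an f.p. homotopy
`H : X_{α'} × I → P` from `f0 ∘ p_{αα'}` to `f1 ∘ p_{αα'}` with `Sh` and `H ∘ (p_{α'} × 1_I)`
`𝒰`-near. -/
theorem fibResolution_approx_homotopy_lift (B0 : Type u) [TopologicalSpace B0]
    [MetrizableSpace B0] (X : Type u) [TopologicalSpace X] (πX : X → B0) (hπX : Continuous πX)
    (S : FibInvSys B0) (p : FibMapToSys X πX S) (hres : IsFibResolution X πX S p)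
    (P : Type u) [TopologicalSpace P] (πP : P → B0) (hP : IsFiberANR B0 P πP)
    (a : S.Idx) (f0 f1 : S.obj a → P)
    (hf0 : IsFPMap (S.proj a) πP f0) (hf1 : IsFPMap (S.proj a) πP f1)
    (Sh : X × unitInterval → P) (hSh : Continuous Sh)
    (hShfp : ∀ x t, πP (Sh (x, t)) = πX x)
    (hSh0 : ∀ x, Sh (x, 0) = f0 (p.maps a x)) (hSh1 : ∀ x, Sh (x, 1) = f1 (p.maps a x))
    (𝒰 : Set (Set P)) (h𝒰 : IsOpenCover 𝒰) :
    ∃ (a' : S.Idx) (h : S.le a a') (H : S.obj a' × unitInterval → P),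
      Continuous H ∧ (∀ y t, πP (H (y, t)) = S.proj a' y) ∧
      (∀ y, H (y, 0) = f0 (S.bond a a' h y)) ∧
      (∀ y, H (y, 1) = f1 (S.bond a a' h y)) ∧
      UNear 𝒰 Sh fun zt : X × unitInterval => H (p.maps a' zt.1, zt.2) := by
  by_cases hne : Nonempty P
  swap
  · have hem : ∀ y : S.obj a, False := fun y => hne ⟨f0 y⟩
    refine ⟨a, S.le_refl a, fun z => (hem z.1).elim, ?_, fun y => (hem y).elim,
      fun y => (hem y).elim, fun y => (hem y).elim, fun z => (hem (p.maps a z.1)).elim⟩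
    rw [continuous_iff_continuousAt]
    exact fun z => (hem z.1).elim
  have hPm := hP.1
  have hπP := hP.2.1
  have hPe := anr_to_ane B0 P πP hP
  obtain ⟨q0⟩ := id hne
  have hEne : Nonempty (FE πP) := ⟨⟨(ContinuousMap.const _ q0, q0, q0), fun _ => rfl, rfl⟩⟩
  have hEπ : Continuous fun e : FE πP => πP e.1.2.1 := by fun_prop
  have hE : IsFiberANR B0 (FE πP) (fun e => πP e.1.2.1) :=
    ane_to_anr B0 _ _ (FE_metr πP) hEπ (FE_ane B0 P πP hPe)
  obtain ⟨D, hD⟩ : ∃ D : Set (FE πP), D = {e | e.1.1 0 = e.1.2.1 ∧ e.1.1 1 = e.1.2.2} :=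
    ⟨_, rfl⟩
  obtain ⟨hDc, W, R, hW, hDW, hR, hRp, hR0, hR1, hRD⟩ := FE_corr B0 P πP hπP hPe D hD
  obtain ⟨𝒱, h𝒱, hR2⟩ := hres.2 (FE πP) inferInstance _ hE {W, Dᶜ} (by
    refine ⟨?_, ?_⟩
    · rintro V (rfl | rfl)
      · exact hW
      · exact hDc.isOpen_compl
    · rw [sUnion_pair, eq_univ_iff_forall]
      intro e
      by_cases he : e ∈ D
      · exact Or.inl (hDW he)
      · exact Or.inr he)
  choose V hVo hVm hV using FE_cover B0 P πP D hD hDc W R hW hDW hR hRD 𝒰 h𝒰 𝒱 h𝒱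
  let h : X → FE πP := fun x => ⟨(⟨fun t => Sh (x, t), by fun_prop⟩, Sh (x, 0), Sh (x, 1)),
    fun t => (hShfp x t).trans (hShfp x 0).symm, (hShfp x 1).trans (hShfp x 0).symm⟩
  have hD' : ∀ x, h x ∈ D := fun x => by rw [hD]; exact ⟨rfl, rfl⟩
  have hhc : Continuous h := by
    refine Continuous.subtype_mk (Continuous.prodMk ?_ (by fun_prop)) _
    exact ContinuousMap.continuous_of_continuous_uncurry _ hSh
  obtain ⟨b, g, hg, hgn⟩ := hres.1 (FE πP) inferInstance _ hE (range V) ⟨by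
      rintro _ ⟨e, rfl⟩; exact hVo e, eq_univ_of_forall fun e => ⟨V e, ⟨e, rfl⟩, hVm e⟩⟩
    h ⟨hhc, fun x => hShfp x 0⟩
  obtain ⟨c, hac, hbc⟩ := S.directed a b
  have hgc : Continuous fun y => g (S.bond b c hbc y) := hg.1.comp (S.bond_cont _ _ _)
  have hgc1 : Continuous fun y => (g (S.bond b c hbc y)).1.1 :=
    continuous_fst.comp (continuous_subtype_val.comp hgc)
  have hgp : ∀ y, πP (g (S.bond b c hbc y)).1.2.1 = S.proj c y := fun y =>
    (hg.2 _).trans (S.bond_fp _ _ _ _)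
  have hf0p : ∀ y, πP (f0 (S.bond a c hac y)) = S.proj c y := fun y =>
    (hf0.2 _).trans (S.bond_fp _ _ _ _)
  have hf1p : ∀ y, πP (f1 (S.bond a c hac y)) = S.proj c y := fun y =>
    (hf1.2 _).trans (S.bond_fp _ _ _ _)
  let k : S.obj c → FE πP := fun y => ⟨((g (S.bond b c hbc y)).1.1,
    f0 (S.bond a c hac y), f1 (S.bond a c hac y)),
    fun t => ((g (S.bond b c hbc y)).2.1 t).trans ((hgp y).trans (hf0p y).symm),
    (hf1p y).trans (hf0p y).symm⟩
  have hkc : Continuous k := by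
    have h0 : Continuous fun y => f0 (S.bond a c hac y) := hf0.1.comp (S.bond_cont _ _ _)
    have h1 : Continuous fun y => f1 (S.bond a c hac y) := hf1.1.comp (S.bond_cont _ _ _)
    exact Continuous.subtype_mk (hgc1.prodMk (h0.prodMk h1)) _
  let k0 : S.obj c → FE πP := fun y => FEend πP (g (S.bond b c hbc y))
  have hk0c : Continuous k0 := Continuous.subtype_mk (hgc1.prodMk
    ((hgc1.eval continuous_const).prodMk (hgc1.eval continuous_const))) _
  -- comparison on `X`
  have hcmp : ∀ x, (∃ U ∈ 𝒱, k0 (p.maps c x) ∈ U ∧ k (p.maps c x) ∈ U) ∧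
      ∀ t, ∃ U ∈ 𝒰, Sh (x, t) ∈ U ∧ R (k (p.maps c x), t) ∈ U := by
    intro x
    obtain ⟨_, ⟨e, rfl⟩, h1, h2⟩ := hgn x
    have hgx : g (S.bond b c hbc (p.maps c x)) = g (p.maps b x) := by rw [p.comm]
    have hpp : πP (g (p.maps b x)).1.2.1 = πP (h x).1.2.1 := by
      exact (hg.2 _).trans ((p.fp _ _).trans (hShfp x 0).symm)
    have hkx : k (p.maps c x) = FEmix πP (g (p.maps b x)) (h x) hpp := by
      apply Subtype.ext
      refine Prod.ext ?_ (Prod.ext ?_ ?_)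
      · change (g (S.bond b c hbc (p.maps c x))).1.1 = (g (p.maps b x)).1.1
        rw [hgx]
      · change f0 (S.bond a c hac (p.maps c x)) = Sh (x, 0)
        rw [p.comm, hSh0]
      · change f1 (S.bond a c hac (p.maps c x)) = Sh (x, 1)
        rw [p.comm, hSh1]
    have hk0x : k0 (p.maps c x) = FEend πP (g (p.maps b x)) := by
      change FEend πP (g (S.bond b c hbc (p.maps c x))) = _
      rw [hgx]
    rw [hkx, hk0x]
    exact hV e _ h2 _ h1 (hD' x) hpp
  obtain ⟨d, hcd, hnear⟩ := hR2 c k0 k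
    ⟨hk0c, fun y => ((g (S.bond b c hbc y)).2.1 0).trans (hgp y)⟩
    ⟨hkc, hf0p⟩ (fun x => (hcmp x).1)
  have hkW : ∀ y, k (S.bond c d hcd y) ∈ W := by
    intro y
    obtain ⟨V', (rfl | rfl), h1, h2⟩ := hnear y
    · exact h2
    · exact absurd (by rw [hD]; exact ⟨rfl, rfl⟩) h1
  refine ⟨d, S.le_trans _ _ _ hac hcd, fun z => R (k (S.bond c d hcd z.1), z.2), ?_, ?_, ?_, ?_, ?_⟩
  · have hb := S.bond_cont c d hcd
    exact hR.comp_continuous (by fun_prop) (fun z => ⟨hkW z.1, trivial⟩)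
  · intro y t
    exact (hRp _ (hkW y) t).trans ((hf0p _).trans (S.bond_fp _ _ _ _))
  · intro y
    refine (hR0 _ (hkW y)).trans ?_
    rw [← S.bond_comp a c d hac hcd]
  · intro y
    refine (hR1 _ (hkW y)).trans ?_
    rw [← S.bond_comp a c d hac hcd]
  · rintro ⟨x, t⟩
    simp only [p.comm]
    exact (hcmp x).2 t
end
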